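/- (Blow-up Lemma of Komlós, Sárközy and Szemerédi.) Given a graph F on vertex set [k] and positive numbers d, Δ, there is η₀ = η₀(d, Δ, k) > 0 such that the following holds for all positive integers ℓ₁, …, ℓ_k and all 0 < η ≤ η₀. Let F' be the graph obtained from F by replacing each vertex i of F with a set V_i of ℓ_i new vertices and joining all vertices of V_i to all vertices of V_j whenever ij ∈ E(F). Let G' be a spanning subgraph of F' such that for every edge ij ∈ E(F) the bipartite graph (V_i, V_j)_{G'} is (η,d)-super-regular. Then G' contains a copy of every subgraph H of F' with maximum degree Δ(H) ≤ Δ; moreover, this copy of H in G' maps each vertex of H to the same set V_i as the given copy of H in F'. -/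

import Mathlib

open Set

namespace ArxivOG

variable {V : Type*}

/-- An oriented graph: at most one directed edge between any two vertices (and no loops). -/
def IsOriented (G : V → V → Prop) : Prop := ∀ x y : V, G x y → ¬ G y x

/-- Out-neighbourhood of a vertex. -/
def outN (G : V → V → Prop) (x : V) : Set V := {y | G x y}

/-- In-neighbourhood of a vertex. -/
def inN (G : V → V → Prop) (x : V) : Set V := {y | G y x}

/-- Outdegree of a vertex. -/
noncomputable def outDeg (G : V → V → Prop) (x : V) : ℕ := (outN G x).ncard

/-- Indegree of a vertex. -/
noncomputable def inDeg (G : V → V → Prop) (x : V) : ℕ := (inN G x).ncard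

/-- The set of all outneighbours of vertices in `S`. -/
def outNSet (G : V → V → Prop) (S : Set V) : Set V := {y | ∃ x ∈ S, G x y}

/-- Minimum outdegree `δ⁺`. -/
noncomputable def minOutDeg (G : V → V → Prop) : ℕ := sInf (Set.range (outDeg G))

/-- Minimum indegree `δ⁻`. -/
noncomputable def minInDeg (G : V → V → Prop) : ℕ := sInf (Set.range (inDeg G))

/-- Minimum semi-degree `δ⁰ = min (δ⁺, δ⁻)`. -/
noncomputable def minSemiDeg (G : V → V → Prop) : ℕ := min (minOutDeg G) (minInDeg G)

/-- A Hamilton cycle of a digraph, encoded as a permutation `σ` of the vertex set all of whose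
vertices lie on a single cycle and such that every vertex sends an edge to its successor. -/
def IsHamCycle (G : V → V → Prop) (σ : Equiv.Perm V) : Prop :=
  (∀ v, G v (σ v)) ∧ ∀ v w : V, σ.SameCycle v w

/-- The number of edges directed from `A` to `B`. -/
noncomputable def eCnt (G : V → V → Prop) (A B : Set V) : ℕ :=
  {p : V × V | p.1 ∈ A ∧ p.2 ∈ B ∧ G p.1 p.2}.ncard

/-- The density of the bipartite graph of all `A`–`B` edges. -/
noncomputable def dens (G : V → V → Prop) (A B : Set V) : ℝ :=
  (eCnt G A B : ℝ) / ((A.ncard : ℝ) * (B.ncard : ℝ))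

/-- The pair `(A,B)` is `ε`-regular. -/
def EpsRegular (ε : ℝ) (G : V → V → Prop) (A B : Set V) : Prop :=
  ∀ X ⊆ A, ∀ Y ⊆ B, ε * A.ncard < (X.ncard : ℝ) → ε * B.ncard < (Y.ncard : ℝ) →
    |dens G X Y - dens G A B| < ε

/-- The pair `(A,B)` is `(ε,d)`-super-regular. -/
def SuperRegular (ε d : ℝ) (G : V → V → Prop) (A B : Set V) : Prop :=
  EpsRegular ε G A B ∧
  (∀ a ∈ A, (d - ε) * B.ncard ≤ ((outN G a ∩ B).ncard : ℝ)) ∧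
  (∀ b ∈ B, (d - ε) * A.ncard ≤ ((inN G b ∩ A).ncard : ℝ))

/-- The cluster `V_i` of a partition encoded by `P : V → Option (Fin k)`. -/
def cluster {k : ℕ} (P : V → Option (Fin k)) (i : Fin k) : Set V := {x | P x = some i}

/-- The exceptional set `V₀` of a partition encoded by `P : V → Option (Fin k)`. -/
def cluster0 {k : ℕ} (P : V → Option (Fin k)) : Set V := {x | P x = none}

namespace BlowUp

open scoped Classical

/-- The host graph `G`, the guest graph `H`, the partition of their common vertex set into
clusters and the numerical parameters for the greedy embedding of `H` into `G`. -/
structure Setting (α ι : Type*) [Fintype α] where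
  part : α → ι
  R : ι → ι → Prop
  R_symm : ∀ i j, R i j → R j i
  R_irrefl : ∀ i, ¬ R i i
  G : SimpleGraph α
  H : SimpleGraph α
  part_H : ∀ x y, H.Adj x y → R (part x) (part y)
  dens : ι → ι → ℝ
  Δ : ℕ
  γ : ℝ
  ε : ℝ
  e : ℝ
  γ_pos : 0 < γ
  γ_le : γ ≤ 1 / 2
  ε_pos : 0 < ε
  ε_le_one : ε ≤ 1
  e_pos : 0 < e
  le_dens : ∀ i j, R i j → 3 / 2 * γ ≤ dens i j
  dens_le : ∀ i j, R i j → dens i j ≤ 1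
  degree_le : ∀ x, (Finset.univ.filter (H.Adj x)).card ≤ Δ
  sum_deviation_le : ∀ i j, R i j → ∀ S ⊆ Finset.univ.filter (part · = i),
    ∑ v with part v = j, |((S.filter (G.Adj v)).card : ℝ) - dens j i * S.card| ≤
      e * (Finset.univ.filter (part · = i)).card * (Finset.univ.filter (part · = j)).card
  le_degree : ∀ v j, R (part v) j →
    γ * (Finset.univ.filter (part · = j)).card ≤
      (((Finset.univ.filter (part · = j)).filter (G.Adj v)).card : ℝ)

/-- A partial embedding `f` with domain `D`, together with the candidate sets `C` and their
expected relative sizes `p`. Both are frozen once a vertex is embedded. -/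
structure State (α : Type*) where
  D : Finset α
  f : α → α
  C : α → Finset α
  p : α → ℝ

lemma abs_card_mul_sub_le {d p p' m w : ℝ} {s t : ℕ}
    (hd : 0 ≤ d) (hd' : d ≤ 1) (h : |(t : ℝ) - d * s| ≤ w) (hp : p' = p * d) :
    |(t : ℝ) - p' * m| ≤ |(s : ℝ) - p * m| + w := by
  have : (t : ℝ) - p' * m = ((t : ℝ) - d * s) + d * (s - p * m) := by rw [hp]; ring
  rw [this]
  refine (abs_add_le _ _).trans ?_
  rw [abs_mul, abs_of_nonneg hd]
  nlinarith [abs_nonneg ((s : ℝ) - p * m)]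

namespace Setting

variable {α ι : Type*} [Fintype α] (B : Setting α ι)

/-- The cluster with index `i`. -/
noncomputable def cl (i : ι) : Finset α := Finset.univ.filter (B.part · = i)

/-- The size of the cluster with index `i`. -/
noncomputable def n (i : ι) : ℝ := (B.cl i).card

/-- The neighbourhood of a vertex in the guest graph. -/
noncomputable def nb (x : α) : Finset α := Finset.univ.filter (B.H.Adj x)

/-- The lower bound for the relative size of candidate sets. -/
def c₀ : ℝ := B.γ ^ B.Δ

@[simp] lemma mem_cl {i : ι} {v : α} : v ∈ B.cl i ↔ B.part v = i := by simp [cl]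

@[simp] lemma mem_nb {x y : α} : y ∈ B.nb x ↔ B.H.Adj x y := by simp [nb]

lemma n_nonneg (i : ι) : 0 ≤ B.n i := by simp [n]

lemma n_pos_of_part (x : α) : 0 < B.n (B.part x) := by
  simp only [n, Nat.cast_pos, Finset.card_pos]
  exact ⟨x, by simp⟩

lemma card_nb_le (x : α) : (B.nb x).card ≤ B.Δ := B.degree_le x

lemma c₀_pos : 0 < B.c₀ := pow_pos B.γ_pos _

lemma c₀_le_pow {s : ℕ} (hs : s ≤ B.Δ) : B.c₀ ≤ B.γ ^ s :=
  pow_le_pow_of_le_one B.γ_pos.le (by linarith [B.γ_le]) hs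

lemma pow_le_one' (s : ℕ) : B.γ ^ s ≤ 1 :=
  pow_le_one₀ B.γ_pos.le (by linarith [B.γ_le])

lemma c₀_le_one : B.c₀ ≤ 1 := B.pow_le_one' _

lemma card_le_n {i : ι} {S : Finset α} (h : S ⊆ B.cl i) : (S.card : ℝ) ≤ B.n i := by
  simpa [n] using Finset.card_le_card h

/-- The number of embedded neighbours of `x`. -/
noncomputable def emb (σ : State α) (x : α) : ℕ := (B.nb x ∩ σ.D).card

lemma emb_le (σ : State α) (x : α) : B.emb σ x ≤ B.Δ :=
  (Finset.card_le_card Finset.inter_subset_left).trans (B.card_nb_le x)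

/-- The vertices of cluster `i` which are not yet used by the partial embedding. -/
noncomputable def free (σ : State α) (i : ι) : Finset α := B.cl i \ σ.D.image σ.f

/-- Deviation of the size of a candidate set from its expectation. -/
noncomputable def dev₁ (σ : State α) (x : α) : ℝ :=
  |((σ.C x).card : ℝ) - σ.p x * B.n (B.part x)|

/-- Deviation of the size of the intersection of two candidate sets from its expectation. -/
noncomputable def dev₂ (σ : State α) (i : ι) (x y : α) : ℝ :=
  |((σ.C x ∩ σ.C y).card : ℝ) - σ.p x * σ.p y * B.n i|

/-- The total irregularity of the candidate sets of cluster `i`. -/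
noncomputable def irreg (σ : State α) (i : ι) : ℝ :=
  2 * B.n i * ∑ x ∈ B.cl i, B.dev₁ σ x + ∑ x ∈ B.cl i, ∑ y ∈ B.cl i, B.dev₂ σ i x y

/-- The weighted number of edges between the embedded vertices and cluster `i`. -/
noncomputable def load (ω : α → ℝ) (D : Finset α) (i : ι) : ℝ :=
  ∑ z ∈ D, ω z * (B.nb z ∩ B.cl i).card

/-- The deviation of the neighbourhood of `v` on `S ⊆ cl i`. -/
noncomputable def err (v : α) (i : ι) (S : Finset α) : ℝ :=
  |((S.filter (B.G.Adj v)).card : ℝ) - B.dens (B.part v) i * S.card|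

/-- The invariant maintained by the embedding process. -/
structure Valid (ω : α → ℝ) (σ : State α) : Prop where
  part_f : ∀ z ∈ σ.D, B.part (σ.f z) = B.part z
  injOn : Set.InjOn σ.f σ.D
  adj : ∀ x ∈ σ.D, ∀ y ∈ σ.D, B.H.Adj x y → B.G.Adj (σ.f x) (σ.f y)
  C_sub : ∀ x, σ.C x ⊆ B.cl (B.part x)
  mem_C : ∀ x, x ∉ σ.D → ∀ v, B.part v = B.part x →
    (v ∈ σ.C x ↔ ∀ z ∈ σ.D, B.H.Adj x z → B.G.Adj (σ.f z) v)
  p_le : ∀ x, σ.p x ≤ 1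
  le_p : ∀ x, B.c₀ ≤ σ.p x
  pow_le_p : ∀ x, x ∉ σ.D → B.γ ^ B.emb σ x ≤ σ.p x
  pow_le_C : ∀ x, x ∉ σ.D → B.γ ^ B.emb σ x * B.n (B.part x) ≤ (σ.C x).card
  irreg_le : ∀ i, (B.Δ : ℝ) ≤ B.ε * B.n i →
    B.irreg σ i ≤ 5 * B.n i ^ 2 * B.load ω σ.D i

/-- Embed `z` at `v` and update the candidate sets of the unembedded neighbours of `z`. -/
noncomputable def step (σ : State α) (z v : α) : State α where
  D := insert z σ.D
  f := Function.update σ.f z v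
  C y := if B.H.Adj z y ∧ y ∉ σ.D then (σ.C y).filter (B.G.Adj v) else σ.C y
  p y := if B.H.Adj z y ∧ y ∉ σ.D then σ.p y * B.dens (B.part v) (B.part y) else σ.p y

/-- The conditions which allow to embed `z` at `v` with error `ω`. -/
structure Step (ω : ℝ) (σ : State α) (z v : α) : Prop where
  notMem : z ∉ σ.D
  mem_C : v ∈ σ.C z
  mem_free : v ∈ B.free σ (B.part z)
  shrink : ∀ y, B.H.Adj z y → y ∉ σ.D →
    B.γ * (σ.C y).card ≤ (((σ.C y).filter (B.G.Adj v)).card : ℝ)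
  err_le : ∀ y, B.H.Adj z y → y ∉ σ.D → B.err v (B.part y) (σ.C y) ≤ ω * B.n (B.part y)
  sum_err_le : ∀ y, B.H.Adj z y → y ∉ σ.D →
    ∑ y' ∈ B.cl (B.part y), B.err v (B.part y) (σ.C y ∩ σ.C y') ≤ ω * B.n (B.part y) ^ 2

variable {B} {ω : α → ℝ} {σ : State α} {z v : α}

lemma mem_free {i : ι} : v ∈ B.free σ i ↔ B.part v = i ∧ ∀ x ∈ σ.D, σ.f x ≠ v := by
  simp [free]

lemma Step.part_eq {w : ℝ} (h : B.Step w σ z v) : B.part v = B.part z :=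
  (Setting.mem_free.1 h.mem_free).1

lemma Valid.p_nonneg (h : B.Valid ω σ) (x : α) : 0 ≤ σ.p x := B.c₀_pos.le.trans (h.le_p x)

lemma emb_step_of_adj (hz : z ∉ σ.D) {y : α} (hy : B.H.Adj z y) :
    B.emb (B.step σ z v) y = B.emb σ y + 1 := by
  simp only [emb, step]
  rw [Finset.inter_insert_of_mem (by simpa using hy.symm), Finset.card_insert_of_notMem]
  simp [hz]

lemma emb_step_of_not_adj {y : α} (hy : ¬ B.H.Adj z y) :
    B.emb (B.step σ z v) y = B.emb σ y := by
  simp only [emb, step]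
  rw [Finset.inter_insert_of_notMem]
  simpa [B.H.adj_comm] using hy

lemma dev₁_step_le {w : ℝ} (hs : B.Step w σ z v) (x : α) :
    B.dev₁ (B.step σ z v) x ≤
      B.dev₁ σ x + if B.H.Adj z x ∧ x ∉ σ.D then w * B.n (B.part x) else 0 := by
  unfold dev₁ step
  dsimp only
  split_ifs with hx
  · have hR := B.part_H _ _ hx.1
    rw [← hs.part_eq] at hR
    refine abs_card_mul_sub_le ?_ (B.dens_le _ _ hR) (hs.err_le x hx.1 hx.2) rfl
    linarith [B.le_dens _ _ hR, B.γ_pos]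
  · simp

lemma dev₂_step_le (h : B.Valid ω σ) {w : ℝ} (hs : B.Step w σ z v) {i : ι} {x y : α}
    (hxi : B.part x = i) (hyi : B.part y = i) :
    B.dev₂ (B.step σ z v) i x y ≤ B.dev₂ σ i x y +
      (if B.H.Adj z x ∧ x ∉ σ.D then B.err v i (σ.C x ∩ σ.C y) else 0) +
      (if B.H.Adj z y ∧ y ∉ σ.D then B.err v i (σ.C y ∩ σ.C x) else 0) +
      (if B.H.Adj z x ∧ x ∉ σ.D then (if B.H.Adj z y ∧ y ∉ σ.D then B.n i else 0) else 0) := by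
  have key : ∀ x y, B.part x = i → (B.H.Adj z x ∧ x ∉ σ.D) →
      |((((σ.C x).filter (B.G.Adj v)) ∩ σ.C y).card : ℝ) -
        σ.p x * B.dens (B.part v) (B.part x) * σ.p y * B.n i| ≤
      B.dev₂ σ i x y + B.err v i (σ.C x ∩ σ.C y) := by
    intro x y hxi hx
    have hR := B.part_H _ _ hx.1
    rw [← hs.part_eq] at hR
    rw [Finset.filter_inter, dev₂]
    refine abs_card_mul_sub_le (d := B.dens (B.part v) (B.part x)) ?_
      (B.dens_le _ _ hR) ?_ (by ring)
    · linarith [B.le_dens _ _ hR, B.γ_pos]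
    · rw [err, hxi]
  have e0 : ∀ S, 0 ≤ B.err v i S := fun S => abs_nonneg _
  by_cases hx : B.H.Adj z x ∧ x ∉ σ.D <;> by_cases hy : B.H.Adj z y ∧ y ∉ σ.D
  · have hR := B.part_H _ _ hx.1
    have hR' := B.part_H _ _ hy.1
    rw [← hs.part_eq] at hR hR'
    have h1 : 0 ≤ B.dens (B.part v) (B.part x) := by linarith [B.le_dens _ _ hR, B.γ_pos]
    have h2 : 0 ≤ B.dens (B.part v) (B.part y) := by linarith [B.le_dens _ _ hR', B.γ_pos]
    simp only [if_pos hx, if_pos hy]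
    have h3 : B.dev₂ (B.step σ z v) i x y ≤ B.n i := by
      rw [dev₂]
      have a1 : ((((B.step σ z v).C x) ∩ ((B.step σ z v).C y)).card : ℝ) ≤ B.n i := by
        apply B.card_le_n
        refine Finset.inter_subset_left.trans ?_
        simp only [step, if_pos hx]
        rw [← hxi]
        exact (Finset.filter_subset _ _).trans (h.C_sub x)
      have a2 : (B.step σ z v).p x ≤ 1 := by
        simp only [step, if_pos hx]
        exact mul_le_one₀ (h.p_le x) h1 (B.dens_le _ _ hR)
      have a3 : (B.step σ z v).p y ≤ 1 := by
        simp only [step, if_pos hy]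
        exact mul_le_one₀ (h.p_le y) h2 (B.dens_le _ _ hR')
      have a4 : 0 ≤ (B.step σ z v).p x := by
        simp only [step, if_pos hx]
        exact mul_nonneg (h.p_nonneg x) h1
      have a5 : 0 ≤ (B.step σ z v).p y := by
        simp only [step, if_pos hy]
        exact mul_nonneg (h.p_nonneg y) h2
      have a6 := B.n_nonneg i
      have a7 : (B.step σ z v).p x * (B.step σ z v).p y ≤ 1 := mul_le_one₀ a2 a5 a3
      rw [abs_le]
      constructor
      · have := mul_le_mul_of_nonneg_right a7 a6
        have : (0 : ℝ) ≤ ((((B.step σ z v).C x) ∩ ((B.step σ z v).C y)).card : ℝ) := by positivity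
        linarith
      · have : 0 ≤ (B.step σ z v).p x * (B.step σ z v).p y * B.n i := by positivity
        linarith
    have : 0 ≤ B.dev₂ σ i x y := abs_nonneg _
    linarith [e0 (σ.C x ∩ σ.C y), e0 (σ.C y ∩ σ.C x)]
  · have := key x y hxi hx
    simp only [if_pos hx, if_neg hy]
    simp only [dev₂, step, if_pos hx, if_neg hy] at this ⊢
    linarith
  · have := key y x hyi hy
    simp only [if_pos hy, if_neg hx]
    simp only [dev₂, step, if_pos hy, if_neg hx] at this ⊢
    rw [Finset.inter_comm, Finset.inter_comm (σ.C x)]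
    simp only [add_zero]
    convert this using 2
    · ring_nf
    · ring_nf
  · simp only [if_neg hx, if_neg hy]
    simp [dev₂, step, if_neg hx, if_neg hy]

lemma irreg_step_le (h : B.Valid ω σ) {w : ℝ} (hs : B.Step w σ z v) {i : ι} (hw : 0 ≤ w)
    (hi : (B.Δ : ℝ) ≤ w * B.n i) :
    B.irreg (B.step σ z v) i ≤
      B.irreg σ i + 5 * B.n i ^ 2 * (w * (B.nb z ∩ B.cl i).card) := by
  set A := (B.cl i).filter (fun x => B.H.Adj z x ∧ x ∉ σ.D) with hA
  have hAsub : A ⊆ B.nb z ∩ B.cl i := by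
    intro x hx
    simp only [hA, Finset.mem_filter, mem_cl] at hx
    simp [hx.1, hx.2.1]
  have hAcard : (A.card : ℝ) ≤ (B.nb z ∩ B.cl i).card := by
    exact_mod_cast Finset.card_le_card hAsub
  have hAΔ : (A.card : ℝ) ≤ B.Δ := by
    exact_mod_cast (Finset.card_le_card (hAsub.trans Finset.inter_subset_left)).trans
      (B.card_nb_le z)
  have hn := B.n_nonneg i
  have h1 : ∑ x ∈ B.cl i, B.dev₁ (B.step σ z v) x ≤
      ∑ x ∈ B.cl i, B.dev₁ σ x + A.card * (w * B.n i) := by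
    calc _ ≤ ∑ x ∈ B.cl i, (B.dev₁ σ x + if B.H.Adj z x ∧ x ∉ σ.D then w * B.n i else 0) := by
          refine Finset.sum_le_sum fun x hx => ?_
          have := dev₁_step_le hs x
          rwa [(B.mem_cl).1 hx] at this
      _ = _ := by
          rw [Finset.sum_add_distrib, ← Finset.sum_filter, Finset.sum_const, nsmul_eq_mul]
  have herr : ∀ x ∈ A, ∑ y ∈ B.cl i, B.err v i (σ.C x ∩ σ.C y) ≤ w * B.n i ^ 2 := by
    intro x hx
    simp only [hA, Finset.mem_filter, mem_cl] at hx
    have := hs.sum_err_le x hx.2.1 hx.2.2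
    rwa [hx.1] at this
  have hS1 : ∑ x ∈ B.cl i, ∑ y ∈ B.cl i,
      (if B.H.Adj z x ∧ x ∉ σ.D then B.err v i (σ.C x ∩ σ.C y) else 0) ≤
      A.card * (w * B.n i ^ 2) := by
    calc _ = ∑ x ∈ A, ∑ y ∈ B.cl i, B.err v i (σ.C x ∩ σ.C y) := by
          rw [hA, Finset.sum_filter]
          refine Finset.sum_congr rfl fun x _ => ?_
          split_ifs <;> simp
      _ ≤ ∑ x ∈ A, w * B.n i ^ 2 := Finset.sum_le_sum herr
      _ = _ := by rw [Finset.sum_const, nsmul_eq_mul]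
  have hS2 : ∑ x ∈ B.cl i, ∑ y ∈ B.cl i,
      (if B.H.Adj z y ∧ y ∉ σ.D then B.err v i (σ.C y ∩ σ.C x) else 0) ≤
      A.card * (w * B.n i ^ 2) := by
    rw [Finset.sum_comm]
    exact hS1
  have hS3 : ∑ x ∈ B.cl i, ∑ y ∈ B.cl i, (if B.H.Adj z x ∧ x ∉ σ.D then
      (if B.H.Adj z y ∧ y ∉ σ.D then B.n i else 0) else 0) = A.card * (A.card * B.n i) := by
    calc _ = ∑ x ∈ A, ∑ y ∈ A, B.n i := by
          rw [hA, Finset.sum_filter]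
          refine Finset.sum_congr rfl fun x _ => ?_
          split_ifs
          · rw [Finset.sum_filter]
          · simp
      _ = _ := by simp
  have h2 : ∑ x ∈ B.cl i, ∑ y ∈ B.cl i, B.dev₂ (B.step σ z v) i x y ≤
      ∑ x ∈ B.cl i, ∑ y ∈ B.cl i, B.dev₂ σ i x y + A.card * (w * B.n i ^ 2) +
        A.card * (w * B.n i ^ 2) + A.card * (A.card * B.n i) := by
    calc _ ≤ ∑ x ∈ B.cl i, ∑ y ∈ B.cl i, (B.dev₂ σ i x y +
      (if B.H.Adj z x ∧ x ∉ σ.D then B.err v i (σ.C x ∩ σ.C y) else 0) +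
      (if B.H.Adj z y ∧ y ∉ σ.D then B.err v i (σ.C y ∩ σ.C x) else 0) +
      (if B.H.Adj z x ∧ x ∉ σ.D then (if B.H.Adj z y ∧ y ∉ σ.D then B.n i else 0) else 0)) := by
          refine Finset.sum_le_sum fun x hx => Finset.sum_le_sum fun y hy => ?_
          exact dev₂_step_le h hs (B.mem_cl.1 hx) (B.mem_cl.1 hy)
      _ ≤ _ := by
          simp only [Finset.sum_add_distrib]
          linarith
  have h3 : (A.card : ℝ) * (A.card * B.n i) ≤ A.card * (w * B.n i ^ 2) := by
    refine mul_le_mul_of_nonneg_left ?_ (by positivity)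
    nlinarith
  have h4 : (A.card : ℝ) * (w * B.n i ^ 2) ≤ (B.nb z ∩ B.cl i).card * (w * B.n i ^ 2) :=
    mul_le_mul_of_nonneg_right hAcard (by positivity)
  unfold irreg
  nlinarith [mul_le_mul_of_nonneg_left h1 (mul_nonneg zero_le_two hn)]

lemma Valid.step (h : B.Valid ω σ) (hω : B.ε ≤ ω z) (hs : B.Step (ω z) σ z v) :
    B.Valid ω (B.step σ z v) := by
  have hzD := hs.notMem
  have hpv := hs.part_eq
  have hne : ∀ x ∈ σ.D, x ≠ z := fun x hx hxz => hzD (hxz ▸ hx)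
  have hf : ∀ x ∈ σ.D, (B.step σ z v).f x = σ.f x := fun x hx =>
    Function.update_of_ne (hne x hx) _ _
  have hfz : (B.step σ z v).f z = v := by simp [Setting.step]
  have hdens : ∀ y, B.H.Adj z y → B.γ ≤ B.dens (B.part v) (B.part y) ∧
      B.dens (B.part v) (B.part y) ≤ 1 := by
    intro y hy
    have hR := B.part_H _ _ hy
    rw [← hpv] at hR
    exact ⟨by linarith [B.le_dens _ _ hR, B.γ_pos], B.dens_le _ _ hR⟩
  have hmem : ∀ x ∈ σ.D, B.H.Adj x z → B.G.Adj (σ.f x) v := fun x hx hxz =>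
    (h.mem_C z hzD v hpv).1 hs.mem_C x hx hxz.symm
  have hpow : ∀ x, x ∉ (B.step σ z v).D → B.γ ^ B.emb (B.step σ z v) x ≤ (B.step σ z v).p x := by
    intro x hx
    have hxD : x ∉ σ.D := fun hh => hx (Finset.mem_insert_of_mem hh)
    by_cases hzx : B.H.Adj z x
    · rw [emb_step_of_adj hzD hzx]
      simp only [Setting.step, if_pos (And.intro hzx hxD)]
      rw [pow_succ]
      exact mul_le_mul (h.pow_le_p x hxD) (hdens x hzx).1 B.γ_pos.le (h.p_nonneg x)
    · rw [emb_step_of_not_adj hzx]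
      simp only [Setting.step, if_neg (fun hh : B.H.Adj z x ∧ x ∉ σ.D => hzx hh.1)]
      exact h.pow_le_p x hxD
  refine ⟨?_, ?_, ?_, ?_, ?_, ?_, ?_, hpow, ?_, ?_⟩
  · intro x hx
    rcases Finset.mem_insert.1 hx with rfl | hx
    · rw [hfz, hpv]
    · rw [hf x hx, h.part_f x hx]
  · have hv := (mem_free.1 hs.mem_free).2
    intro x hx y hy hxy
    rcases Finset.mem_insert.1 hx with rfl | hx' <;> rcases Finset.mem_insert.1 hy with rfl | hy'
    · rfl
    · rw [hfz, hf y hy'] at hxy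
      exact absurd hxy.symm (hv y hy')
    · rw [hfz, hf x hx'] at hxy
      exact absurd hxy (hv x hx')
    · rw [hf x hx', hf y hy'] at hxy
      exact h.injOn hx' hy' hxy
  · intro x hx y hy hxy
    rcases Finset.mem_insert.1 hx with rfl | hx' <;> rcases Finset.mem_insert.1 hy with rfl | hy'
    · exact absurd hxy (B.H.irrefl)
    · rw [hfz, hf y hy']
      exact (hmem y hy' hxy.symm).symm
    · rw [hfz, hf x hx']
      exact hmem x hx' hxy
    · rw [hf x hx', hf y hy']
      exact h.adj x hx' y hy' hxy
  · intro x
    simp only [Setting.step]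
    split_ifs
    · exact (Finset.filter_subset _ _).trans (h.C_sub x)
    · exact h.C_sub x
  · intro x hx u hu
    have hxD : x ∉ σ.D := fun hh => hx (Finset.mem_insert_of_mem hh)
    have hD : (B.step σ z v).D = insert z σ.D := rfl
    rw [hD, Finset.forall_mem_insert, hfz]
    have h1 : (∀ y ∈ σ.D, B.H.Adj x y → B.G.Adj ((B.step σ z v).f y) u) ↔ u ∈ σ.C x := by
      rw [h.mem_C x hxD u hu]
      refine forall₂_congr fun y hy => ?_
      rw [hf y hy]
    rw [h1]
    simp only [Setting.step]
    split_ifs with hc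
    · simp [hc.1.symm, and_comm]
    · have : ¬ B.H.Adj x z := fun hh => hc ⟨hh.symm, hxD⟩
      simp [this]
  · intro x
    simp only [Setting.step]
    split_ifs with hc
    · exact mul_le_one₀ (h.p_le x) (B.γ_pos.le.trans (hdens x hc.1).1) (hdens x hc.1).2
    · exact h.p_le x
  · intro x
    by_cases hx : x ∈ (B.step σ z v).D
    · have : ¬ (B.H.Adj z x ∧ x ∉ σ.D) := by
        rintro ⟨h1, h2⟩
        rcases Finset.mem_insert.1 hx with rfl | hx
        · exact B.H.irrefl h1
        · exact h2 hx
      simp only [Setting.step, if_neg this]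
      exact h.le_p x
    · exact (B.c₀_le_pow (B.emb_le _ x)).trans (hpow x hx)
  · intro x hx
    have hxD : x ∉ σ.D := fun hh => hx (Finset.mem_insert_of_mem hh)
    by_cases hzx : B.H.Adj z x
    · rw [emb_step_of_adj hzD hzx]
      simp only [Setting.step, if_pos (And.intro hzx hxD)]
      refine le_trans ?_ (hs.shrink x hzx hxD)
      rw [pow_succ]
      nlinarith [h.pow_le_C x hxD, B.γ_pos]
    · rw [emb_step_of_not_adj hzx]
      simp only [Setting.step, if_neg (fun hh : B.H.Adj z x ∧ x ∉ σ.D => hzx hh.1)]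
      exact h.pow_le_C x hxD
  · intro i hi
    have h0 : 0 ≤ ω z := B.ε_pos.le.trans hω
    have h1 := irreg_step_le h hs (i := i) h0
      (hi.trans (mul_le_mul_of_nonneg_right hω (B.n_nonneg i)))
    have h2 := h.irreg_le i hi
    have h3 : B.load ω (B.step σ z v).D i =
        ω z * (B.nb z ∩ B.cl i).card + B.load ω σ.D i := by
      simp only [load, Setting.step]
      rw [Finset.sum_insert hzD]
    rw [h3]
    linarith

/-- Two states, the second of which extends the first. -/
structure Ext (B : Setting α ι) (σ τ : State α) : Prop where
  D_sub : σ.D ⊆ τ.D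
  f_eq : ∀ x ∈ σ.D, τ.f x = σ.f x
  C_eq : ∀ x, B.nb x ⊆ σ.D → τ.C x = σ.C x

lemma Ext.refl : B.Ext σ σ := ⟨Finset.Subset.refl _, fun _ _ => rfl, fun _ _ => rfl⟩

lemma Ext.trans {τ υ : State α} (h : B.Ext σ τ) (h' : B.Ext τ υ) : B.Ext σ υ :=
  ⟨h.D_sub.trans h'.D_sub, fun x hx => (h'.f_eq x (h.D_sub hx)).trans (h.f_eq x hx),
    fun x hx => (h'.C_eq x (hx.trans h.D_sub)).trans (h.C_eq x hx)⟩

lemma Ext.free_sub {τ : State α} (h : B.Ext σ τ) (i : ι) : B.free τ i ⊆ B.free σ i := by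
  intro u hu
  rw [mem_free] at hu ⊢
  exact ⟨hu.1, fun x hx => by rw [← h.f_eq x hx]; exact hu.2 x (h.D_sub hx)⟩

lemma Ext.step (hz : z ∉ σ.D) : B.Ext σ (B.step σ z v) := by
  refine ⟨Finset.subset_insert _ _, fun x hx => ?_, fun x hx => ?_⟩
  · exact Function.update_of_ne (fun h : x = z => hz (h ▸ hx)) _ _
  · simp only [Setting.step]
    rw [if_neg]
    rintro ⟨h1, -⟩
    exact hz (hx (B.mem_nb.2 h1.symm))

/-- The state in which no vertex is embedded. -/
noncomputable def start (B : Setting α ι) : State α where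
  D := ∅
  f := id
  C x := B.cl (B.part x)
  p _ := 1

lemma valid_start (ω : α → ℝ) : B.Valid ω B.start := by
  refine ⟨?_, ?_, ?_, ?_, ?_, ?_, ?_, ?_, ?_, ?_⟩ <;> try simp [start]
  · exact fun _ => B.c₀_le_one
  · intro x
    exact B.pow_le_one' _
  · intro x
    have := B.pow_le_one' (B.emb B.start x)
    have h2 := B.n_nonneg (B.part x)
    change _ ≤ B.n (B.part x)
    exact mul_le_of_le_one_left h2 this
  · intro i _
    have h1 : ∑ x ∈ B.cl i, B.dev₁ B.start x = 0 :=
      Finset.sum_eq_zero fun x _ => by simp [dev₁, start, n]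
    have h2 : ∑ x ∈ B.cl i, ∑ y ∈ B.cl i, B.dev₂ B.start i x y = 0 :=
      Finset.sum_eq_zero fun x hx => Finset.sum_eq_zero fun y hy => by
        rw [mem_cl] at hx hy
        simp [dev₂, start, n, hx, hy]
    change B.irreg B.start i ≤ _
    rw [irreg, h1, h2]
    simp [load]

lemma Valid.card_free (h : B.Valid ω σ) (i : ι) :
    (B.free σ i).card = (B.cl i \ σ.D).card := by
  have h1 : (B.cl i ∩ σ.D.image σ.f) = (B.cl i ∩ σ.D).image σ.f := by
    ext u
    simp only [Finset.mem_inter, mem_cl, Finset.mem_image]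
    constructor
    · rintro ⟨hu, x, hx, rfl⟩
      exact ⟨x, ⟨by rw [← h.part_f x hx, hu], hx⟩, rfl⟩
    · rintro ⟨x, ⟨hxi, hx⟩, rfl⟩
      exact ⟨by rw [h.part_f x hx, hxi], x, hx, rfl⟩
  have h2 : ((B.cl i ∩ σ.D).image σ.f).card = (B.cl i ∩ σ.D).card :=
    Finset.card_image_of_injOn (h.injOn.mono (by intro x; simp))
  have h3 := Finset.card_sdiff_add_card_inter (B.cl i) (σ.D.image σ.f)
  have h4 := Finset.card_sdiff_add_card_inter (B.cl i) σ.D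
  rw [h1, h2] at h3
  simp only [free]
  omega

lemma Valid.card_C_inter_free (h : B.Valid ω σ) (x : α) :
    ((σ.C x).card : ℝ) - (B.cl (B.part x) ∩ σ.D).card ≤
      (σ.C x ∩ B.free σ (B.part x)).card := by
  set i := B.part x
  have h1 := h.card_free i
  have h3 := Finset.card_sdiff_add_card_inter (B.cl i) σ.D
  have h5 : (σ.C x ∪ B.free σ i).card ≤ (B.cl i).card :=
    Finset.card_le_card (Finset.union_subset (h.C_sub x) Finset.sdiff_subset)
  have h6 := Finset.card_union_add_card_inter (σ.C x) (B.free σ i)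
  have h7 : (σ.C x).card ≤ (σ.C x ∩ B.free σ i).card + (B.cl i ∩ σ.D).card := by omega
  have : ((σ.C x).card : ℝ) ≤ (σ.C x ∩ B.free σ i).card + (B.cl i ∩ σ.D).card := by
    exact_mod_cast h7
  linarith

/-- The vertices `v` for which embedding `z` at `v` keeps all candidate sets well-behaved. -/
def Typical (B : Setting α ι) (σ : State α) (z v : α) : Prop :=
  ∀ y, B.H.Adj z y → y ∉ σ.D →
    B.err v (B.part y) (σ.C y) ≤ B.ε * B.n (B.part y) ∧
    ∑ y' ∈ B.cl (B.part y), B.err v (B.part y) (σ.C y ∩ σ.C y') ≤ B.ε * B.n (B.part y) ^ 2 ∧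
    B.err v (B.part y) (σ.C y ∩ B.free σ (B.part y)) ≤ B.ε * B.n (B.part y)

lemma err_nonneg (v : α) (i : ι) (S : Finset α) : 0 ≤ B.err v i S := abs_nonneg _

lemma mul_card_filter_lt_le {β : Type*} {S : Finset β} {g : β → ℝ} {a b : ℝ} (hg : ∀ u ∈ S, 0 ≤ g u)
    (h : ∑ u ∈ S, g u ≤ b) : a * (S.filter (fun u => a < g u)).card ≤ b := by
  calc a * (S.filter (fun u => a < g u)).card = ∑ u ∈ S.filter (fun u => a < g u), a := by
        rw [Finset.sum_const, nsmul_eq_mul, mul_comm]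
    _ ≤ ∑ u ∈ S.filter (fun u => a < g u), g u :=
        Finset.sum_le_sum fun u hu => (Finset.mem_filter.1 hu).2.le
    _ ≤ ∑ u ∈ S, g u := Finset.sum_le_sum_of_subset_of_nonneg (Finset.filter_subset _ _)
        fun u hu _ => hg u hu
    _ ≤ b := h

lemma sum_err_le {i j : ι} (hR : B.R i j) {S : Finset α} (hS : S ⊆ B.cl i) :
    ∑ u ∈ B.cl j, B.err u i S ≤ B.e * B.n i * B.n j := by
  have := B.sum_deviation_le i j hR S hS
  refine le_trans (le_of_eq ?_) this
  refine Finset.sum_congr rfl fun u hu => ?_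
  rw [err, B.mem_cl.1 hu]

lemma card_not_typical_le (hC : ∀ x, σ.C x ⊆ B.cl (B.part x)) (z : α) :
    B.ε * ((B.cl (B.part z)).filter (fun u => ¬ B.Typical σ z u)).card ≤
      3 * B.Δ * B.e * B.n (B.part z) := by
  set j := B.part z with hj
  let T₁ : α → Finset α := fun y => (B.cl j).filter
    (fun u => B.ε * B.n (B.part y) < B.err u (B.part y) (σ.C y))
  let T₂ : α → Finset α := fun y => (B.cl j).filter
    (fun u => B.ε * B.n (B.part y) ^ 2 <
      ∑ y' ∈ B.cl (B.part y), B.err u (B.part y) (σ.C y ∩ σ.C y'))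
  let T₃ : α → Finset α := fun y => (B.cl j).filter
    (fun u => B.ε * B.n (B.part y) < B.err u (B.part y) (σ.C y ∩ B.free σ (B.part y)))
  have hsub : (B.cl j).filter (fun u => ¬ B.Typical σ z u) ⊆
      (B.nb z).biUnion (fun y => T₁ y ∪ T₂ y ∪ T₃ y) := by
    intro u hu
    rw [Finset.mem_filter, Typical] at hu
    push Not at hu
    obtain ⟨huj, y, hzy, -, hy⟩ := hu
    simp only [Finset.mem_biUnion, Finset.mem_union, T₁, T₂, T₃, Finset.mem_filter]
    refine ⟨y, by simpa using hzy, ?_⟩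
    by_cases h1 : B.err u (B.part y) (σ.C y) ≤ B.ε * B.n (B.part y)
    · by_cases h2 : ∑ y' ∈ B.cl (B.part y), B.err u (B.part y) (σ.C y ∩ σ.C y') ≤
          B.ε * B.n (B.part y) ^ 2
      · exact Or.inr ⟨huj, hy h1 h2⟩
      · exact Or.inl (Or.inr ⟨huj, not_le.1 h2⟩)
    · exact Or.inl (Or.inl ⟨huj, not_le.1 h1⟩)
  have hb : ∀ y ∈ B.nb z, B.ε * ((T₁ y ∪ T₂ y ∪ T₃ y).card : ℝ) ≤ 3 * (B.e * B.n j) := by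
    intro y hy
    have hR := B.R_symm _ _ (B.part_H _ _ (B.mem_nb.1 hy))
    have hn := B.n_pos_of_part y
    have h1 : B.ε * ((T₁ y).card : ℝ) ≤ B.e * B.n j := by
      have := mul_card_filter_lt_le (a := B.ε * B.n (B.part y))
        (fun u _ => err_nonneg u (B.part y) (σ.C y)) (sum_err_le hR (hC y))
      refine le_of_mul_le_mul_right ?_ hn
      linarith
    have h3 : B.ε * ((T₃ y).card : ℝ) ≤ B.e * B.n j := by
      have := mul_card_filter_lt_le (a := B.ε * B.n (B.part y))
        (fun u _ => err_nonneg u (B.part y) (σ.C y ∩ B.free σ (B.part y)))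
        (sum_err_le hR (Finset.inter_subset_left.trans (hC y)))
      refine le_of_mul_le_mul_right ?_ hn
      linarith
    have h2 : B.ε * ((T₂ y).card : ℝ) ≤ B.e * B.n j := by
      have h4 : ∑ u ∈ B.cl j, ∑ y' ∈ B.cl (B.part y), B.err u (B.part y) (σ.C y ∩ σ.C y') ≤
          B.n (B.part y) * (B.e * B.n (B.part y) * B.n j) := by
        rw [Finset.sum_comm]
        calc _ ≤ ∑ y' ∈ B.cl (B.part y), B.e * B.n (B.part y) * B.n j :=
              Finset.sum_le_sum fun y' _ =>
                sum_err_le hR (Finset.inter_subset_left.trans (hC y))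
          _ = _ := by rw [Finset.sum_const, nsmul_eq_mul]; rfl
      have := mul_card_filter_lt_le (a := B.ε * B.n (B.part y) ^ 2)
        (fun u _ => Finset.sum_nonneg fun y' _ => err_nonneg u (B.part y) (σ.C y ∩ σ.C y')) h4
      refine le_of_mul_le_mul_right ?_ (pow_pos hn 2)
      linarith
    have h5 : ((T₁ y ∪ T₂ y ∪ T₃ y).card : ℝ) ≤ (T₁ y).card + (T₂ y).card + (T₃ y).card := by
      exact_mod_cast (Finset.card_union_le _ _).trans
        (Nat.add_le_add_right (Finset.card_union_le _ _) _)
    have := mul_le_mul_of_nonneg_left h5 B.ε_pos.le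
    linarith
  have h6 : (((B.cl j).filter (fun u => ¬ B.Typical σ z u)).card : ℝ) ≤
      ∑ y ∈ B.nb z, ((T₁ y ∪ T₂ y ∪ T₃ y).card : ℝ) := by
    exact_mod_cast (Finset.card_le_card hsub).trans Finset.card_biUnion_le
  calc _ ≤ B.ε * ∑ y ∈ B.nb z, ((T₁ y ∪ T₂ y ∪ T₃ y).card : ℝ) :=
        mul_le_mul_of_nonneg_left h6 B.ε_pos.le
    _ ≤ ∑ y ∈ B.nb z, 3 * (B.e * B.n j) := by
        rw [Finset.mul_sum]
        exact Finset.sum_le_sum hb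
    _ = (B.nb z).card * (3 * (B.e * B.n j)) := by rw [Finset.sum_const, nsmul_eq_mul]
    _ ≤ B.Δ * (3 * (B.e * B.n j)) := by
        have := B.e_pos
        have := B.n_nonneg j
        refine mul_le_mul_of_nonneg_right ?_ (by positivity)
        exact_mod_cast B.card_nb_le z
    _ = _ := by ring

lemma exists_typical (hC : ∀ x, σ.C x ⊆ B.cl (B.part x)) {U : Finset α}
    (hU : U ⊆ B.cl (B.part z)) (hcard : 3 * B.Δ * B.e * B.n (B.part z) < B.ε * U.card) :
    ∃ u ∈ U, B.Typical σ z u := by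
  by_contra! hcon
  have h1 : U ⊆ (B.cl (B.part z)).filter (fun u => ¬ B.Typical σ z u) := fun u hu =>
    Finset.mem_filter.2 ⟨hU hu, hcon u hu⟩
  have h2 : (U.card : ℝ) ≤ ((B.cl (B.part z)).filter (fun u => ¬ B.Typical σ z u)).card := by
    exact_mod_cast Finset.card_le_card h1
  have h3 := mul_le_mul_of_nonneg_left h2 B.ε_pos.le
  linarith [card_not_typical_le hC z]

lemma err_ge {y : α} (hv : B.part v = B.part z) (hzy : B.H.Adj z y) {S : Finset α} {a : ℝ}
    (h : B.err v (B.part y) S ≤ a) :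
    3 / 2 * B.γ * S.card - a ≤ ((S.filter (B.G.Adj v)).card : ℝ) := by
  have hR := B.part_H _ _ hzy
  rw [← hv] at hR
  have h1 := (abs_le.1 h).1
  have := mul_le_mul_of_nonneg_right (B.le_dens _ _ hR) (Nat.cast_nonneg (α := ℝ) S.card)
  linarith

lemma Valid.step_of_typical (h : B.Valid ω σ) (hε : B.ε ≤ B.γ * B.c₀ / 2) {w : ℝ} (hw : B.ε ≤ w)
    (hz : z ∉ σ.D) (hvC : v ∈ σ.C z) (hvf : v ∈ B.free σ (B.part z)) (ht : B.Typical σ z v) :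
    B.Step w σ z v := by
  refine ⟨hz, hvC, hvf, fun y hzy hy => ?_, fun y hzy hy => ?_, fun y hzy hy => ?_⟩
  · have h1 := err_ge (mem_free.1 hvf).1 hzy (ht y hzy hy).1
    have h2 : B.c₀ * B.n (B.part y) ≤ (σ.C y).card :=
      (mul_le_mul_of_nonneg_right (B.c₀_le_pow (B.emb_le σ y)) (B.n_nonneg _)).trans
        (h.pow_le_C y hy)
    have h3 := mul_le_mul_of_nonneg_right hε (B.n_nonneg (B.part y))
    have h4 := mul_le_mul_of_nonneg_left h2 B.γ_pos.le
    linarith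
  · exact (ht y hzy hy).1.trans (mul_le_mul_of_nonneg_right hw (B.n_nonneg _))
  · exact (ht y hzy hy).2.1.trans (mul_le_mul_of_nonneg_right hw (sq_nonneg _))

lemma Valid.exists_step (h : B.Valid ω σ) (hε : B.ε ≤ B.γ * B.c₀ / 2) {w : ℝ} (hw : B.ε ≤ w)
    (hz : z ∉ σ.D) (hcard : 3 * B.Δ * B.e * B.n (B.part z) <
      B.ε * (σ.C z ∩ B.free σ (B.part z)).card) :
    ∃ v, B.Typical σ z v ∧ B.Step w σ z v := by
  obtain ⟨v, hv, ht⟩ := exists_typical h.C_sub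
    (Finset.inter_subset_left.trans (h.C_sub z)) hcard
  rw [Finset.mem_inter] at hv
  exact ⟨v, ht, h.step_of_typical hε hw hz hv.1 hv.2 ht⟩

/-- Greedy embedding of a set `Z` of vertices. -/
lemma Valid.exists_extend (h : B.Valid ω σ) (hε : B.ε ≤ B.γ * B.c₀ / 2) (hω : ∀ z, B.ε ≤ ω z)
    (Z : Finset α)
    (hZ : ∀ τ, B.Valid ω τ → σ.D ⊆ τ.D → τ.D ⊆ σ.D ∪ Z → ∀ z ∈ Z, z ∉ τ.D →
      3 * B.Δ * B.e * B.n (B.part z) < B.ε * (τ.C z ∩ B.free τ (B.part z)).card) :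
    ∃ τ, B.Valid ω τ ∧ B.Ext σ τ ∧ τ.D = σ.D ∪ Z := by
  suffices H : ∀ Y ⊆ Z, ∃ τ, B.Valid ω τ ∧ B.Ext σ τ ∧ τ.D = σ.D ∪ Y from H Z subset_rfl
  intro Y
  induction Y using Finset.induction_on with
  | empty => exact fun _ => ⟨σ, h, Ext.refl, by simp⟩
  | insert z Y hzY ih =>
    intro hY
    obtain ⟨τ, hτ, hext, hD⟩ := ih ((Finset.subset_insert _ _).trans hY)
    by_cases hz : z ∈ τ.D
    · exact ⟨τ, hτ, hext, by rw [Finset.union_insert, ← hD, Finset.insert_eq_of_mem hz]⟩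
    · have h1 : τ.D ⊆ σ.D ∪ Z := by
        rw [hD]
        exact Finset.union_subset_union_right ((Finset.subset_insert _ _).trans hY)
      obtain ⟨v, -, hv⟩ := hτ.exists_step hε (hω z) hz
        (hZ τ hτ hext.D_sub h1 z (hY (Finset.mem_insert_self _ _)) hz)
      refine ⟨B.step τ z v, hτ.step (hω z) hv, hext.trans (Ext.step hz), ?_⟩
      rw [Finset.union_insert, ← hD]
      rfl

/-- Few vertices have an unexpectedly small number of candidates in a large set. -/
lemma Valid.sq_mul_le_irreg (h : B.Valid ω σ) {i : ι} {X W : Finset α} (hX : X ⊆ B.cl i)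
    (hW : W ⊆ B.cl i) {t : ℝ} (ht : 0 ≤ t) (ht' : 2 * t ≤ B.c₀)
    (hsum : ∑ x ∈ X, ((σ.C x ∩ W).card : ℝ) ≤ X.card * (t * W.card)) :
    t ^ 2 * X.card ^ 2 * W.card ≤ B.irreg σ i := by
  set a : α → α → ℝ := fun x u => σ.p x - if u ∈ σ.C x then 1 else 0 with ha
  set g : α → ℝ := fun u => ∑ x ∈ X, a x u with hg
  have hC : ∀ x ∈ B.cl i, σ.C x ⊆ B.cl i := fun x hx => by
    have := h.C_sub x
    rwa [B.mem_cl.1 hx] at this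
  have hind : ∀ S T : Finset α, ∑ u ∈ T, (if u ∈ S then (1 : ℝ) else 0) = (S ∩ T).card := by
    intro S T
    rw [Finset.sum_boole, Finset.filter_mem_eq_inter, Finset.inter_comm]
  have h1 : t * X.card * W.card ≤ ∑ u ∈ W, g u := by
    have e1 : ∑ u ∈ W, g u = ∑ x ∈ X, (σ.p x * W.card - (σ.C x ∩ W).card) := by
      rw [hg, Finset.sum_comm]
      refine Finset.sum_congr rfl fun x _ => ?_
      simp only [ha, Finset.sum_sub_distrib, hind, Finset.sum_const, nsmul_eq_mul]
      ring
    have e2 : X.card * (2 * t * W.card) ≤ ∑ x ∈ X, σ.p x * W.card := by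
      rw [← nsmul_eq_mul, ← Finset.sum_const]
      refine Finset.sum_le_sum fun x _ => ?_
      exact mul_le_mul_of_nonneg_right (ht'.trans (h.le_p x)) (by positivity)
    rw [e1, Finset.sum_sub_distrib]
    linarith
  have h2 : ∑ u ∈ B.cl i, g u ^ 2 ≤ B.irreg σ i := by
    have e1 : ∀ x ∈ B.cl i, ∀ y ∈ B.cl i, ∑ u ∈ B.cl i, a x u * a y u ≤
        B.dev₂ σ i x y + B.dev₁ σ x + B.dev₁ σ y := by
      intro x hx y hy
      have e2 : ∑ u ∈ B.cl i, a x u * a y u = ((σ.C x ∩ σ.C y).card - σ.p x * σ.p y * B.n i) -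
          σ.p x * ((σ.C y).card - σ.p y * B.n i) - σ.p y * ((σ.C x).card - σ.p x * B.n i) := by
        have e3 : ∀ u, a x u * a y u = σ.p x * σ.p y - σ.p x * (if u ∈ σ.C y then 1 else 0) -
            σ.p y * (if u ∈ σ.C x then 1 else 0) +
            (if u ∈ σ.C x ∩ σ.C y then 1 else 0) := by
          intro u
          simp only [ha, Finset.mem_inter]
          split_ifs <;> simp_all <;> ring
        simp only [e3, Finset.sum_add_distrib, Finset.sum_sub_distrib, ← Finset.mul_sum, hind,
          Finset.sum_const, nsmul_eq_mul]
        rw [Finset.inter_eq_left.2 (hC x hx), Finset.inter_eq_left.2 (hC y hy),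
          Finset.inter_eq_left.2 (Finset.inter_subset_left.trans (hC x hx))]
        simp only [n]
        ring
      have e4 : B.dev₁ σ x = |((σ.C x).card : ℝ) - σ.p x * B.n i| := by
        rw [dev₁, B.mem_cl.1 hx]
      have e5 : B.dev₁ σ y = |((σ.C y).card : ℝ) - σ.p y * B.n i| := by
        rw [dev₁, B.mem_cl.1 hy]
      rw [e2, e4, e5, dev₂]
      have k1 := le_abs_self (((σ.C x ∩ σ.C y).card : ℝ) - σ.p x * σ.p y * B.n i)
      have k : ∀ (q b : ℝ), 0 ≤ q → q ≤ 1 → -(q * b) ≤ |b| := by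
        intro q b hq hq'
        calc -(q * b) ≤ |q * b| := neg_le_abs _
          _ = q * |b| := by rw [abs_mul, abs_of_nonneg hq]
          _ ≤ |b| := mul_le_of_le_one_left (abs_nonneg _) hq'
      have k2 := k (σ.p x) ((σ.C y).card - σ.p y * B.n i) (h.p_nonneg x) (h.p_le x)
      have k3 := k (σ.p y) ((σ.C x).card - σ.p x * B.n i) (h.p_nonneg y) (h.p_le y)
      linarith
    have d1 : ∀ x, 0 ≤ B.dev₁ σ x := fun x => abs_nonneg _
    have d2 : ∀ x y, 0 ≤ B.dev₂ σ i x y := fun x y => abs_nonneg _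
    calc ∑ u ∈ B.cl i, g u ^ 2 = ∑ x ∈ X, ∑ y ∈ X, ∑ u ∈ B.cl i, a x u * a y u := by
          simp only [hg, sq, Finset.sum_mul_sum]
          rw [Finset.sum_comm]
          refine Finset.sum_congr rfl fun x _ => Finset.sum_comm
      _ ≤ ∑ x ∈ X, ∑ y ∈ X, (B.dev₂ σ i x y + B.dev₁ σ x + B.dev₁ σ y) :=
          Finset.sum_le_sum fun x hx => Finset.sum_le_sum fun y hy => e1 x (hX hx) y (hX hy)
      _ ≤ ∑ x ∈ B.cl i, ∑ y ∈ B.cl i, (B.dev₂ σ i x y + B.dev₁ σ x + B.dev₁ σ y) := by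
          refine (Finset.sum_le_sum fun x _ => ?_).trans
            (Finset.sum_le_sum_of_subset_of_nonneg hX fun x _ _ => ?_)
          · exact Finset.sum_le_sum_of_subset_of_nonneg hX fun y _ _ => by
              linarith [d1 x, d1 y, d2 x y]
          · exact Finset.sum_nonneg fun y _ => by linarith [d1 x, d1 y, d2 x y]
      _ = B.irreg σ i := by
          simp only [Finset.sum_add_distrib, Finset.sum_const, nsmul_eq_mul, irreg, n,
            ← Finset.mul_sum]
          ring
  have h3 : (∑ u ∈ W, g u) ^ 2 ≤ W.card * ∑ u ∈ W, g u ^ 2 := sq_sum_le_card_mul_sum_sq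
  have h4 : ∑ u ∈ W, g u ^ 2 ≤ ∑ u ∈ B.cl i, g u ^ 2 :=
    Finset.sum_le_sum_of_subset_of_nonneg hW fun u _ _ => sq_nonneg _
  rcases W.eq_empty_or_nonempty with rfl | hne
  · simp only [Finset.card_empty, Nat.cast_zero, mul_zero]
    exact (Finset.sum_nonneg fun u _ => sq_nonneg _).trans h2
  · have hWpos : (0 : ℝ) < W.card := by exact_mod_cast hne.card_pos
    have h5 : (t * X.card * W.card) ^ 2 ≤ (∑ u ∈ W, g u) ^ 2 :=
      pow_le_pow_left₀ (by positivity) h1 2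
    refine le_of_mul_le_mul_left ?_ hWpos
    calc (W.card : ℝ) * (t ^ 2 * X.card ^ 2 * W.card) = (t * X.card * W.card) ^ 2 := by ring
      _ ≤ W.card * ∑ u ∈ W, g u ^ 2 := h5.trans h3
      _ ≤ W.card * B.irreg σ i := mul_le_mul_of_nonneg_left (h4.trans h2) hWpos.le

lemma Valid.half_c₀_sq_mul_le_irreg (h : B.Valid ω σ) {i : ι} {X W : Finset α} (hX : X ⊆ B.cl i)
    (hW : W ⊆ B.cl i)
    (hsum : ∑ x ∈ X, ((σ.C x ∩ W).card : ℝ) ≤ X.card * (B.c₀ / 2 * W.card)) :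
    (B.c₀ / 2) ^ 2 * X.card ^ 2 * W.card ≤ B.irreg σ i :=
  h.sq_mul_le_irreg hX hW (by linarith [B.c₀_pos]) (by linarith) hsum

lemma Valid.C_eq_cl (h : B.Valid ω σ) {x : α} (hx : x ∉ σ.D)
    (hD : ∀ z ∈ σ.D, ¬ B.H.Adj x z) : σ.C x = B.cl (B.part x) := by
  refine Finset.Subset.antisymm (h.C_sub x) fun v hv => ?_
  rw [h.mem_C x hx v (B.mem_cl.1 hv)]
  exact fun z hz hxz => absurd hxz (hD z hz)

lemma err_le_card {i : ι} (hR : B.R (B.part v) i) (S : Finset α) : B.err v i S ≤ S.card := by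
  have h1 : (((S.filter (B.G.Adj v)).card : ℕ) : ℝ) ≤ S.card := by
    exact_mod_cast Finset.card_filter_le _ _
  have h2 := mul_le_mul_of_nonneg_right (B.dens_le _ _ hR) (Nat.cast_nonneg (α := ℝ) S.card)
  have h3 : 0 ≤ B.dens (B.part v) i := by linarith [B.le_dens _ _ hR, B.γ_pos]
  have h4 := mul_nonneg h3 (Nat.cast_nonneg (α := ℝ) S.card)
  rw [err, abs_le]
  constructor
  · have : (0 : ℝ) ≤ (S.filter (B.G.Adj v)).card := Nat.cast_nonneg _
    linarith
  · linarith

/-- A vertex all of whose neighbours have full candidate sets can be embedded anywhere. -/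
lemma Valid.step_of_full (h : B.Valid ω σ) (hz : z ∉ σ.D)
    (hv : v ∈ B.free σ (B.part z)) (hzD : ∀ w ∈ σ.D, ¬ B.H.Adj z w)
    (hD : ∀ y, B.H.Adj z y → ∀ w ∈ σ.D, ¬ B.H.Adj y w) : B.Step 1 σ z v := by
  have hvz := (mem_free.1 hv).1
  have hR : ∀ y, B.H.Adj z y → B.R (B.part v) (B.part y) := fun y hy => by
    rw [hvz]
    exact B.part_H _ _ hy
  refine ⟨hz, by rw [h.C_eq_cl hz hzD]; simpa using hvz, hv, fun y hy hyD => ?_,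
    fun y hy _ => ?_, fun y hy _ => ?_⟩
  · rw [h.C_eq_cl hyD (hD y hy)]
    exact B.le_degree v _ (hR y hy)
  · rw [one_mul]
    exact (err_le_card (hR y hy) _).trans (B.card_le_n (h.C_sub y))
  · calc _ ≤ ∑ y' ∈ B.cl (B.part y), B.n (B.part y) := Finset.sum_le_sum fun y' _ =>
          (err_le_card (hR y hy) _).trans
            (B.card_le_n (Finset.inter_subset_left.trans (h.C_sub y)))
      _ = _ := by
          rw [Finset.sum_const, nsmul_eq_mul, one_mul, sq]
          rfl

/-- The number of unused candidates of `x`. -/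
noncomputable def spare (B : Setting α ι) (σ : State α) (x : α) : ℝ :=
  (σ.C x ∩ B.free σ (B.part x)).card

lemma step_C_sub (y : α) : (B.step σ z v).C y ⊆ σ.C y := by
  simp only [step]
  split_ifs
  · exact Finset.filter_subset _ _
  · exact subset_rfl

lemma free_step (hz : z ∉ σ.D) (i : ι) : B.free (B.step σ z v) i = (B.free σ i).erase v := by
  ext u
  simp only [mem_free, Finset.mem_erase, step, Finset.mem_insert, forall_eq_or_imp,
    Function.update_self]
  have : ∀ x ∈ σ.D, Function.update σ.f z v x = σ.f x := fun x hx =>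
    Function.update_of_ne (fun hxz : x = z => hz (hxz ▸ hx)) _ _
  constructor
  · rintro ⟨h1, h2, h3⟩
    exact ⟨Ne.symm h2, h1, fun x hx => by rw [← this x hx]; exact h3 x hx⟩
  · rintro ⟨h1, h2, h3⟩
    exact ⟨h2, Ne.symm h1, fun x hx => by rw [this x hx]; exact h3 x hx⟩

lemma spare_step_le (hz : z ∉ σ.D) (y : α) : B.spare (B.step σ z v) y ≤ B.spare σ y := by
  refine Nat.cast_le.2 (Finset.card_le_card (Finset.inter_subset_inter (step_C_sub y) ?_))
  rw [free_step hz]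
  exact Finset.erase_subset _ _

/-- The closed neighbourhood of `x` in the guest graph. -/
noncomputable def cn (B : Setting α ι) (x : α) : Finset α := insert x (B.nb x)

lemma mem_cn_comm {x y : α} : x ∈ B.cn y ↔ y ∈ B.cn x := by
  simp [cn, B.H.adj_comm, eq_comm]

lemma mem_cn_self (x : α) : x ∈ B.cn x := Finset.mem_insert_self _ _

lemma nb_sub_cn (x : α) : B.nb x ⊆ B.cn x := Finset.subset_insert _ _

lemma card_biUnion_cn_le (X : Finset α) : (X.biUnion B.cn).card ≤ X.card * (B.Δ + 1) :=
  Finset.card_biUnion_le_card_mul _ _ _ fun x _ =>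
    (Finset.card_insert_le _ _).trans (Nat.add_le_add_right (B.card_nb_le x) 1)

/-- Distinct vertices of `A` have distance at least four in the guest graph. -/
def Far (B : Setting α ι) (A : Finset α) : Prop :=
  ∀ a ∈ A, ∀ b ∈ A, a ≠ b → ∀ x ∈ B.cn a, ∀ y ∈ B.cn x, y ∉ B.cn b

/-- All vertices at distance at most two from `a ∈ A` lie in clusters which are not much
smaller than the cluster of `a`. -/
def Wide (B : Setting α ι) (c : ℝ) (A : Finset α) : Prop :=
  ∀ a ∈ A, ∀ x ∈ B.cn a, ∀ y ∈ B.cn x, c * B.n (B.part a) ≤ B.n (B.part y)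

lemma Far.mono {A A' : Finset α} (h : B.Far A) (hA : A' ⊆ A) : B.Far A' :=
  fun a ha b hb => h a (hA ha) b (hA hb)

lemma Wide.mono {c : ℝ} {A A' : Finset α} (h : B.Wide c A) (hA : A' ⊆ A) : B.Wide c A' :=
  fun a ha => h a (hA ha)

lemma sum_card_nb_inter_le (D : Finset α) (i : ι) :
    ∑ z ∈ D, ((B.nb z ∩ B.cl i).card : ℝ) ≤ B.Δ * B.n i := by
  have h : ∑ z ∈ D, (B.nb z ∩ B.cl i).card ≤ (B.cl i).card * B.Δ := by
    have h1 : ∀ z, (B.nb z ∩ B.cl i).card = ∑ x ∈ B.cl i, if B.H.Adj z x then 1 else 0 := by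
      intro z
      rw [Finset.sum_boole, Nat.cast_id]
      congr 1
      ext x
      simp [and_comm]
    simp only [h1]
    rw [Finset.sum_comm, ← smul_eq_mul, ← Finset.sum_const]
    refine Finset.sum_le_sum fun x _ => ?_
    rw [Finset.sum_boole, Nat.cast_id]
    refine (Finset.card_le_card ?_).trans (B.card_nb_le x)
    intro z hz
    simpa using (Finset.mem_filter.1 hz).2.symm
  calc _ ≤ ((B.cl i).card : ℝ) * B.Δ := by exact_mod_cast h
    _ = _ := mul_comm _ _

/-- The permitted error when a vertex is embedded. -/
noncomputable def weight (B : Setting α ι) (Q : Finset α) (z : α) : ℝ := if z ∈ Q then 1 else B.ε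

/-- The set of all neighbours of `S`. -/
noncomputable def nbs (B : Setting α ι) (S : Finset α) : Finset α := S.biUnion B.nb

lemma ε_le_weight {Q : Finset α} (z : α) : B.ε ≤ B.weight Q z := by
  unfold weight
  split_ifs
  · exact B.ε_le_one
  · exact le_rfl

lemma load_le_of_disjoint {D Q : Finset α} (hD : Disjoint D Q) (i : ι) :
    B.load (B.weight Q) D i ≤ B.ε * B.Δ * B.n i := by
  have h1 : B.load (B.weight Q) D i = B.ε * ∑ z ∈ D, ((B.nb z ∩ B.cl i).card : ℝ) := by
    rw [load, Finset.mul_sum]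
    refine Finset.sum_congr rfl fun z hz => ?_
    rw [weight, if_neg (Finset.disjoint_left.1 hD hz)]
  rw [h1, mul_assoc]
  exact mul_le_mul_of_nonneg_left (sum_card_nb_inter_le D i) B.ε_pos.le

variable [Fintype ι]

lemma sum_card_inter_cl (A : Finset α) : ∑ i, (A ∩ B.cl i).card = A.card := by
  rw [Finset.card_eq_sum_card_fiberwise (f := B.part) (t := Finset.univ) (by simp)]
  refine Finset.sum_congr rfl fun i _ => congrArg _ ?_
  ext; simp

lemma exists_notMem_of_far {A : Finset α} {i : ι} {μ c : ℝ} (hc : 0 ≤ c)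
    (hμc : Fintype.card ι * (B.Δ + 1 : ℝ) ^ 3 * μ + Fintype.card ι * (B.Δ + 1 : ℝ) ^ 2 * c ≤ 1)
    (hA : (A.card : ℝ) < Fintype.card ι * (μ * B.n i)) :
    ∃ b ∈ B.cl i, b ∉ ((A.biUnion B.cn).biUnion B.cn).biUnion B.cn ∧
      ∀ x ∈ B.cn b, ∀ y ∈ B.cn x, c * B.n i ≤ B.n (B.part y) := by
  set F₁ := ((A.biUnion B.cn).biUnion B.cn).biUnion B.cn with hF₁
  set J : Finset ι := Finset.univ.filter (fun j => B.n j < c * B.n i) with hJ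
  set F₂ := ((J.biUnion B.cl).biUnion B.cn).biUnion B.cn with hF₂
  have h1 : F₁.card ≤ A.card * (B.Δ + 1) * (B.Δ + 1) * (B.Δ + 1) :=
    (card_biUnion_cn_le _).trans (Nat.mul_le_mul_right _
      ((card_biUnion_cn_le _).trans (Nat.mul_le_mul_right _ (card_biUnion_cn_le _))))
  have h2 : F₂.card ≤ (∑ j ∈ J, (B.cl j).card) * (B.Δ + 1) * (B.Δ + 1) :=
    (card_biUnion_cn_le _).trans (Nat.mul_le_mul_right _
      ((card_biUnion_cn_le _).trans (Nat.mul_le_mul_right _ Finset.card_biUnion_le)))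
  have h3 : (∑ j ∈ J, (B.cl j).card : ℝ) ≤ Fintype.card ι * (c * B.n i) := by
    have hcn : 0 ≤ c * B.n i := mul_nonneg hc (B.n_nonneg i)
    calc (∑ j ∈ J, (B.cl j).card : ℝ) ≤ ∑ j ∈ J, c * B.n i :=
          Finset.sum_le_sum fun j hj => (Finset.mem_filter.1 hj).2.le
      _ = J.card * (c * B.n i) := by rw [Finset.sum_const, nsmul_eq_mul]
      _ ≤ _ := by
          refine mul_le_mul_of_nonneg_right ?_ hcn
          exact_mod_cast Finset.card_le_univ J
  have h1' : (F₁.card : ℝ) ≤ A.card * (B.Δ + 1 : ℝ) ^ 3 := by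
    calc (F₁.card : ℝ) ≤ A.card * (B.Δ + 1) * (B.Δ + 1) * (B.Δ + 1) := by exact_mod_cast h1
      _ = _ := by ring
  have h2' : (F₂.card : ℝ) ≤ (∑ j ∈ J, (B.cl j).card : ℝ) * (B.Δ + 1 : ℝ) ^ 2 := by
    calc (F₂.card : ℝ) ≤ (∑ j ∈ J, (B.cl j).card : ℝ) * (B.Δ + 1) * (B.Δ + 1) := by
          exact_mod_cast h2
      _ = _ := by ring
  have h4 : ((F₁ ∪ F₂).card : ℝ) < (B.cl i).card := by
    have a1 : ((F₁ ∪ F₂).card : ℝ) ≤ F₁.card + F₂.card := by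
      exact_mod_cast Finset.card_union_le _ _
    have a2 : A.card * (B.Δ + 1 : ℝ) ^ 3 < Fintype.card ι * (μ * B.n i) * (B.Δ + 1 : ℝ) ^ 3 :=
      mul_lt_mul_of_pos_right hA (by positivity)
    have a3 := mul_le_mul_of_nonneg_right h3 (by positivity : (0 : ℝ) ≤ (B.Δ + 1 : ℝ) ^ 2)
    have a4 := mul_le_mul_of_nonneg_right hμc (B.n_nonneg i)
    change _ < B.n i
    linarith
  obtain ⟨b, hb, hbF⟩ := Finset.exists_mem_notMem_of_card_lt_card (by exact_mod_cast h4)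
  rw [Finset.mem_union, not_or] at hbF
  refine ⟨b, hb, hbF.1, fun x hx y hy => ?_⟩
  by_contra hlt
  refine hbF.2 (Finset.mem_biUnion.2 ⟨x, Finset.mem_biUnion.2 ⟨y, Finset.mem_biUnion.2
    ⟨B.part y, ?_, by simp⟩, mem_cn_comm.1 hy⟩, mem_cn_comm.1 hx⟩)
  simpa [hJ] using hlt

lemma exists_far_wide (m : ι → ℕ) {μ c : ℝ} (hμ : 0 ≤ μ) (hc : 0 ≤ c)
    (hm : ∀ i, (m i : ℝ) ≤ μ * B.n i)
    (hμc : Fintype.card ι * (B.Δ + 1 : ℝ) ^ 3 * μ + Fintype.card ι * (B.Δ + 1 : ℝ) ^ 2 * c ≤ 1) :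
    ∃ A, B.Far A ∧ B.Wide c A ∧ ∀ i, (A ∩ B.cl i).card = m i := by
  suffices H : ∀ s : Finset ι, ∃ A, B.Far A ∧ B.Wide c A ∧
      (∀ i ∈ s, (A ∩ B.cl i).card = m i) ∧ ∀ i ∉ s, (A ∩ B.cl i).card = 0 by
    obtain ⟨A, h1, h2, h3, -⟩ := H Finset.univ
    exact ⟨A, h1, h2, fun i => h3 i (Finset.mem_univ i)⟩
  intro s
  induction s using Finset.induction_on_max_value B.n with
  | empty => exact ⟨∅, by simp [Far], by simp [Wide], by simp, by simp⟩
  | insert i s his hmax ih =>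
    obtain ⟨A₀, hfar₀, hwide₀, hs₀, hs₀'⟩ := ih
    suffices H : ∀ t ≤ m i, ∃ A, B.Far A ∧ B.Wide c A ∧ (∀ j ∈ s, (A ∩ B.cl j).card = m j) ∧
        (∀ j ∉ s, j ≠ i → (A ∩ B.cl j).card = 0) ∧ (A ∩ B.cl i).card = t by
      obtain ⟨A, h1, h2, h3, h4, h5⟩ := H (m i) le_rfl
      refine ⟨A, h1, h2, fun j hj => ?_, fun j hj => ?_⟩
      · rcases Finset.mem_insert.1 hj with rfl | hj
        · exact h5
        · exact h3 j hj
      · rw [Finset.mem_insert, not_or] at hj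
        exact h4 j hj.2 hj.1
    intro t
    induction t with
    | zero => exact fun _ => ⟨A₀, hfar₀, hwide₀, hs₀, fun j hj _ => hs₀' j hj, hs₀' i his⟩
    | succ t iht =>
      intro ht
      obtain ⟨A, hfar, hwide, hs, hs', hi⟩ := iht (Nat.le_of_succ_le ht)
      have hti : (t : ℝ) < μ * B.n i :=
        lt_of_lt_of_le (by exact_mod_cast ht) (hm i)
      have hA : (A.card : ℝ) < Fintype.card ι * (μ * B.n i) := by
        rw [← sum_card_inter_cl (B := B) A, Nat.cast_sum, ← nsmul_eq_mul, ← Finset.card_univ,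
          ← Finset.sum_const]
        refine Finset.sum_lt_sum (fun j _ => ?_) ⟨i, Finset.mem_univ _, by rw [hi]; exact hti⟩
        by_cases hj : j ∈ s
        · rw [hs j hj]
          exact (hm j).trans (mul_le_mul_of_nonneg_left (hmax j hj) hμ)
        · by_cases hji : j = i
          · rw [hji, hi]
            exact hti.le
          · rw [hs' j hj hji]
            simpa using mul_nonneg hμ (B.n_nonneg i)
      obtain ⟨b, hbi, hbF, hbw⟩ := exists_notMem_of_far hc hμc hA
      have hbpart := B.mem_cl.1 hbi
      have hpath : ∀ a ∈ A, ∀ x ∈ B.cn a, ∀ y ∈ B.cn x, y ∉ B.cn b := fun a ha x hx y hy hyb =>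
        hbF (Finset.mem_biUnion.2 ⟨y, Finset.mem_biUnion.2 ⟨x, Finset.mem_biUnion.2
          ⟨a, ha, hx⟩, hy⟩, mem_cn_comm.1 hyb⟩)
      have hbA : b ∉ A := fun hbA => hpath b hbA b (mem_cn_self b) b (mem_cn_self b) (mem_cn_self b)
      have hother : ∀ j, j ≠ i → insert b A ∩ B.cl j = A ∩ B.cl j := fun j hj =>
        Finset.insert_inter_of_notMem (by rw [mem_cl, hbpart]; exact hj.symm)
      refine ⟨insert b A, ?_, ?_, fun j hj => ?_, fun j hj hji => ?_, ?_⟩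
      · intro a ha a' ha' hne x hx y hy hya
        rcases Finset.mem_insert.1 ha with hab | haA <;>
          rcases Finset.mem_insert.1 ha' with hab' | haA'
        · exact hne (hab.trans hab'.symm)
        · rw [hab] at hx
          exact hpath a' haA' y hya x (mem_cn_comm.1 hy) hx
        · rw [hab'] at hya
          exact hpath a haA x hx y hy hya
        · exact hfar a haA a' haA' hne x hx y hy hya
      · intro a ha x hx y hy
        rcases Finset.mem_insert.1 ha with rfl | ha
        · rw [hbpart]
          exact hbw x hx y hy
        · exact hwide a ha x hx y hy
      · rw [hother j (fun h => his (h ▸ hj)), hs j hj]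
      · rw [hother j hji, hs' j hj hji]
      · rw [Finset.insert_inter_of_mem hbi, Finset.card_insert_of_notMem, hi]
        simp [hbA]

lemma Wide.mul_sum_card_nb_inter_le {c μ : ℝ} {A : Finset α} (h : B.Wide c A) (hμ : 0 ≤ μ)
    (hc : 0 ≤ c) (hA : ∀ j, ((A ∩ B.cl j).card : ℝ) ≤ μ * B.n j) (i : ι) :
    c * ∑ z ∈ A, ((B.nb z ∩ B.cl i).card : ℝ) ≤ B.Δ * Fintype.card ι * μ * B.n i := by
  have hfib : ∑ z ∈ A, ((B.nb z ∩ B.cl i).card : ℝ) =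
      ∑ j, ∑ z ∈ A ∩ B.cl j, ((B.nb z ∩ B.cl i).card : ℝ) := by
    rw [← Finset.sum_fiberwise A B.part]
    refine Finset.sum_congr rfl fun j _ => Finset.sum_congr ?_ fun _ _ => rfl
    ext; simp
  rw [hfib, Finset.mul_sum]
  have hj : ∀ j, c * ∑ z ∈ A ∩ B.cl j, ((B.nb z ∩ B.cl i).card : ℝ) ≤ B.Δ * μ * B.n i := by
    intro j
    have hrhs : 0 ≤ B.Δ * μ * B.n i := mul_nonneg (mul_nonneg (Nat.cast_nonneg _) hμ) (B.n_nonneg i)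
    by_cases hji : c * B.n j ≤ B.n i
    · calc c * ∑ z ∈ A ∩ B.cl j, ((B.nb z ∩ B.cl i).card : ℝ) ≤
            c * ∑ z ∈ A ∩ B.cl j, (B.Δ : ℝ) := by
            refine mul_le_mul_of_nonneg_left (Finset.sum_le_sum fun z _ => ?_) hc
            exact_mod_cast (Finset.card_le_card Finset.inter_subset_left).trans (B.card_nb_le z)
        _ = c * ((A ∩ B.cl j).card * B.Δ) := by rw [Finset.sum_const, nsmul_eq_mul]
        _ ≤ c * ((μ * B.n j) * B.Δ) := by
            refine mul_le_mul_of_nonneg_left ?_ hc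
            exact mul_le_mul_of_nonneg_right (hA j) (Nat.cast_nonneg _)
        _ = B.Δ * μ * (c * B.n j) := by ring
        _ ≤ B.Δ * μ * B.n i := mul_le_mul_of_nonneg_left hji (by positivity)
    · rw [Finset.sum_eq_zero, mul_zero]
      · exact hrhs
      · intro z hz
        rw [Finset.mem_inter, mem_cl] at hz
        rw [Nat.cast_eq_zero, Finset.card_eq_zero, Finset.eq_empty_iff_forall_notMem]
        intro x hx
        rw [Finset.mem_inter, mem_cl] at hx
        have := h z hz.1 x (nb_sub_cn z hx.1) x (mem_cn_self x)
        rw [hz.2, hx.2] at this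
        exact hji this
  calc _ ≤ ∑ _j : ι, B.Δ * μ * B.n i := Finset.sum_le_sum fun j _ => hj j
    _ = _ := by rw [Finset.sum_const, Finset.card_univ, nsmul_eq_mul]; ring

/-- The numerical parameters of the embedding procedure. -/
structure Params (B : Setting α ι) where
  c : ℝ
  β : ℝ
  ρ : ℝ
  δ : ℝ
  θ : ℝ
  T : ℝ
  L : ℝ
  c_pos : 0 < c
  c_le_one : c ≤ 1
  β_pos : 0 < β
  ρ_pos : 0 < ρ
  δ_pos : 0 < δ
  δ_le : δ ≤ 1 / 2
  θ_pos : 0 < θ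
  T_pos : 0 < T
  small_or_large : ∀ i, B.n i ≤ T ∨ T < c * B.n i
  select : Fintype.card ι * (B.Δ + 1 : ℝ) ^ 3 * (β + ρ) + Fintype.card ι * (B.Δ + 1 : ℝ) ^ 2 * c ≤ 1
  β_le : B.Δ * Fintype.card ι * β ≤ c * (B.c₀ / 8)
  ρ_le : ρ ≤ B.c₀ / 8
  ε_le : B.ε ≤ B.γ * B.c₀ * δ / 2
  Δ_le : (B.Δ : ℝ) ≤ B.ε * T
  β_mul_T : 8 ≤ β * T
  ρ_mul_T : 2 ≤ ρ * T
  δ_mul_T : 1 ≤ δ * T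
  e_le : 3 * B.Δ * B.e ≤ B.ε * (B.c₀ * δ / 4)
  e_mul_T : 3 * B.Δ * B.e * T < B.ε
  e_mul_sq : B.e * T ^ 2 < B.γ
  bad_le : 160 * B.ε * B.Δ ≤ B.c₀ ^ 2 * β ^ 2 * ρ
  load_le : B.Δ * B.ε * c + B.Δ * Fintype.card ι * ρ ≤ L * c
  L_le : 80 * L ≤ B.c₀ ^ 2 * β * θ ^ 2
  δ_le' : 16 * δ ≤ B.c₀ * β
  θ_le : θ ≤ B.c₀ * δ / 2
  L_lt : 40 * L < B.c₀ ^ 3 * δ ^ 2 * β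

namespace Params

variable (P : B.Params)

/-- The cluster `i` is large. -/
def Large (i : ι) : Prop := P.T < P.c * B.n i

variable {P}

lemma Large.lt {i : ι} (h : P.Large i) : P.T < B.n i := by
  have := mul_le_mul_of_nonneg_right P.c_le_one (B.n_nonneg i)
  have h' : P.T < P.c * B.n i := h
  linarith

lemma Large.pos {i : ι} (h : P.Large i) : 0 < B.n i := P.T_pos.trans h.lt

lemma large_of_lt {i : ι} (h : P.T < B.n i) : P.Large i :=
  (P.small_or_large i).resolve_left (not_le.2 h)

lemma n_le_of_not_large {i : ι} (h : ¬ P.Large i) : B.n i ≤ P.T :=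
  (P.small_or_large i).resolve_right h

lemma Large.Δ_le {i : ι} (h : P.Large i) : (B.Δ : ℝ) ≤ B.ε * B.n i :=
  P.Δ_le.trans (mul_le_mul_of_nonneg_left h.lt.le B.ε_pos.le)

lemma ε_le_half (P : B.Params) : B.ε ≤ B.γ * B.c₀ / 2 := by
  have h1 := P.ε_le
  have h2 := P.δ_le
  have h3 : 0 < B.γ * B.c₀ := mul_pos B.γ_pos B.c₀_pos
  nlinarith

lemma typical_card {i : ι} (h : P.Large i) {N : ℝ} (hN : B.c₀ * P.δ / 2 * B.n i ≤ N) :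
    3 * B.Δ * B.e * B.n i < B.ε * N := by
  have h1 := mul_le_mul_of_nonneg_right P.e_le (B.n_nonneg i)
  have h2 := mul_le_mul_of_nonneg_left hN B.ε_pos.le
  have h3 : 0 < B.ε * (B.c₀ * P.δ / 4 * B.n i) :=
    mul_pos B.ε_pos (mul_pos (div_pos (mul_pos B.c₀_pos P.δ_pos) (by norm_num)) h.pos)
  linarith

variable (P)

/-- A set `S` of buffer vertices together with a set `Q` of reserve vertices. -/
structure Buffer (S Q : Finset α) : Prop where
  far : B.Far (S ∪ Q)
  wide : B.Wide P.c (S ∪ Q)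
  disj : Disjoint S Q
  large : ∀ x ∈ S ∪ Q, P.Large (B.part x)
  S_le : ∀ i, ((S ∩ B.cl i).card : ℝ) ≤ P.β * B.n i
  Q_le : ∀ i, ((Q ∩ B.cl i).card : ℝ) ≤ P.ρ * B.n i
  le_S : ∀ i, P.Large i → P.β * B.n i / 2 ≤ (S ∩ B.cl i).card
  le_Q : ∀ i, P.Large i → P.ρ * B.n i / 2 ≤ (Q ∩ B.cl i).card

lemma exists_buffer : ∃ S Q, P.Buffer S Q := by
  set b : ι → ℕ := fun i => if P.Large i then ⌊P.β * B.n i⌋₊ else 0 with hb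
  set r : ι → ℕ := fun i => if P.Large i then ⌊P.ρ * B.n i⌋₊ else 0 with hr
  have hfl : ∀ {μ : ℝ}, 0 < μ → 2 ≤ μ * P.T → ∀ i,
      (((if P.Large i then ⌊μ * B.n i⌋₊ else 0 : ℕ) : ℝ) ≤ μ * B.n i) ∧
      (P.Large i → μ * B.n i / 2 ≤ ((if P.Large i then ⌊μ * B.n i⌋₊ else 0 : ℕ) : ℝ)) := by
    intro μ hμ hμT i
    have h0 : 0 ≤ μ * B.n i := mul_nonneg hμ.le (B.n_nonneg i)
    by_cases hi : P.Large i
    · simp only [if_pos hi]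
      refine ⟨Nat.floor_le h0, fun _ => ?_⟩
      have h1 := Nat.lt_floor_add_one (μ * B.n i)
      have h2 := mul_le_mul_of_nonneg_left hi.lt.le hμ.le
      linarith
    · simp [hi, h0]
  have hb' := hfl P.β_pos (by linarith [P.β_mul_T])
  have hr' := hfl P.ρ_pos P.ρ_mul_T
  obtain ⟨A, hfar, hwide, hA⟩ := B.exists_far_wide (fun i => b i + r i)
    (add_nonneg P.β_pos.le P.ρ_pos.le) P.c_pos.le
    (fun i => by push_cast; linarith [(hb' i).1, (hr' i).1]) P.select
  have hsub : ∀ i, ∃ S ⊆ A ∩ B.cl i, S.card = b i := fun i =>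
    Finset.exists_subset_card_eq (by rw [hA i]; exact Nat.le_add_right _ _)
  choose S hS hScard using hsub
  set S' := Finset.univ.biUnion S with hS'
  have hSA : S' ⊆ A := Finset.biUnion_subset.2 fun i _ => (hS i).trans Finset.inter_subset_left
  have hScl : ∀ i, S' ∩ B.cl i = S i := by
    intro i
    ext x
    simp only [hS', Finset.mem_inter, Finset.mem_biUnion, Finset.mem_univ, true_and]
    constructor
    · rintro ⟨⟨j, hj⟩, hi⟩
      have := (Finset.mem_inter.1 (hS j hj)).2
      rw [mem_cl] at this hi
      rwa [← hi, this]
    · exact fun hx => ⟨⟨i, hx⟩, (Finset.mem_inter.1 (hS i hx)).2⟩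
  have hQcl : ∀ i, ((A \ S') ∩ B.cl i).card = r i := by
    intro i
    have h1 : (A \ S') ∩ B.cl i = (A ∩ B.cl i) \ S i := by
      rw [← hScl i]
      ext x
      simp only [Finset.mem_inter, Finset.mem_sdiff]
      tauto
    rw [h1, Finset.card_sdiff_of_subset (hS i), hA i, hScard i, Nat.add_sub_cancel_left]
  have hun : S' ∪ A \ S' = A := Finset.union_sdiff_of_subset hSA
  refine ⟨S', A \ S', by rwa [hun], by rwa [hun], Finset.disjoint_sdiff, ?_, fun i => ?_,
    fun i => ?_, fun i hi => ?_, fun i hi => ?_⟩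
  · rw [hun]
    intro x hx
    by_contra hl
    have h1 := hA (B.part x)
    simp only [hb, hr, if_neg hl, add_zero, Finset.card_eq_zero,
      Finset.eq_empty_iff_forall_notMem] at h1
    exact h1 x (by simp [hx])
  · rw [hScl, hScard]
    exact (hb' i).1
  · rw [hQcl]
    exact (hr' i).1
  · rw [hScl, hScard]
    exact (hb' i).2 hi
  · rw [hQcl]
    exact (hr' i).2 hi

variable {P} {S Q : Finset α}

lemma Buffer.load_le (h : P.Buffer S Q) (D : Finset α) (i : ι) :
    B.load (B.weight Q) D i ≤ P.L * B.n i := by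
  have h1 : B.load (B.weight Q) D i ≤
      B.load (B.weight Q) (D \ Q) i + ∑ z ∈ Q, ((B.nb z ∩ B.cl i).card : ℝ) := by
    rw [load, ← Finset.sum_inter_add_sum_sdiff D Q, add_comm]
    refine add_le_add le_rfl ?_
    calc _ = ∑ z ∈ D ∩ Q, ((B.nb z ∩ B.cl i).card : ℝ) := by
          refine Finset.sum_congr rfl fun z hz => ?_
          rw [weight, if_pos (Finset.mem_inter.1 hz).2, one_mul]
      _ ≤ _ := Finset.sum_le_sum_of_subset_of_nonneg Finset.inter_subset_right
          fun _ _ _ => Nat.cast_nonneg _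
  have h2 := load_le_of_disjoint (B := B) (D := D \ Q) (Q := Q) Finset.sdiff_disjoint i
  have h3 := (h.wide.mono Finset.subset_union_right).mul_sum_card_nb_inter_le P.ρ_pos.le
    P.c_pos.le h.Q_le i
  have h4 := mul_le_mul_of_nonneg_right P.load_le (B.n_nonneg i)
  refine le_of_mul_le_mul_left ?_ P.c_pos
  have h5 := mul_le_mul_of_nonneg_left (h1.trans (add_le_add_left h2 _)) P.c_pos.le
  linarith

lemma Buffer.large_of_mem (h : P.Buffer S Q) {a x y : α} (ha : a ∈ S ∪ Q) (hx : x ∈ B.cn a)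
    (hy : y ∈ B.cn x) : P.Large (B.part y) :=
  large_of_lt ((h.large a ha).trans_le (h.wide a ha x hx y hy))

lemma Buffer.card_nbs_le (h : P.Buffer S Q) (i : ι) :
    ((B.cl i ∩ B.nbs S).card : ℝ) ≤ B.c₀ / 8 * B.n i := by
  have h1 : ((B.cl i ∩ B.nbs S).card : ℝ) ≤ ∑ z ∈ S, ((B.nb z ∩ B.cl i).card : ℝ) := by
    rw [nbs, Finset.inter_comm, Finset.biUnion_inter]
    exact_mod_cast Finset.card_biUnion_le
  have h2 := (h.wide.mono Finset.subset_union_left).mul_sum_card_nb_inter_le P.β_pos.le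
    P.c_pos.le h.S_le i
  refine le_of_mul_le_mul_left ?_ P.c_pos
  have h3 := mul_le_mul_of_nonneg_left h1 P.c_pos.le
  have h4 := mul_le_mul_of_nonneg_right P.β_le (B.n_nonneg i)
  linarith

lemma adj_of_not_large {u v : α} (hu : ¬ P.Large (B.part u)) (hv : ¬ P.Large (B.part v))
    (hR : B.R (B.part u) (B.part v)) : B.G.Adj v u := by
  by_contra hadj
  have h1 := sum_err_le hR (S := {u}) (by simp)
  have h2 : B.err v (B.part u) {u} ≤ ∑ w ∈ B.cl (B.part v), B.err w (B.part u) {u} :=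
    Finset.single_le_sum (f := fun w => B.err w (B.part u) {u}) (fun w _ => err_nonneg _ _ _)
      (by simp)
  have h3 : B.err v (B.part u) {u} = |B.dens (B.part v) (B.part u)| := by
    simp [err, Finset.filter_singleton, hadj]
  have h4 := B.le_dens _ _ (B.R_symm _ _ hR)
  have h5 : B.n (B.part u) * B.n (B.part v) ≤ P.T * P.T :=
    mul_le_mul (n_le_of_not_large hu) (n_le_of_not_large hv) (B.n_nonneg _) P.T_pos.le
  have h6 := mul_le_mul_of_nonneg_left h5 B.e_pos.le
  have h7 := P.e_mul_sq
  have h8 := le_abs_self (B.dens (B.part v) (B.part u))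
  have h9 := B.γ_pos
  nlinarith

variable (P)

lemma exists_embed_small (Q : Finset α) : ∃ σ, B.Valid (B.weight Q) σ ∧
    σ.D = Finset.univ.filter (fun x => ¬ P.Large (B.part x)) := by
  have hex := (valid_start (B := B) (B.weight Q)).exists_extend P.ε_le_half ε_le_weight
    (Finset.univ.filter (fun x => ¬ P.Large (B.part x)))
  refine (hex ?_).imp fun σ hσ => ⟨hσ.1, by rw [hσ.2.2]; simp [start]⟩
  intro τ hτ _ hD z hz hzD
  replace hz : ¬ P.Large (B.part z) := by simpa using hz
  have hDs : ∀ w ∈ τ.D, ¬ P.Large (B.part w) := fun w hw => by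
    simpa [start] using hD hw
  have h1 : τ.C z ∩ B.free τ (B.part z) = B.free τ (B.part z) := by
    refine Finset.inter_eq_right.2 fun u hu => ?_
    have hu' := (mem_free.1 hu).1
    rw [hτ.mem_C z hzD u hu']
    intro w hw hzw
    refine adj_of_not_large (P := P) (by rwa [hu']) (by rw [hτ.part_f w hw]; exact hDs w hw) ?_
    rw [hu', hτ.part_f w hw]
    exact B.part_H _ _ hzw
  have h2 : 1 ≤ (B.free τ (B.part z)).card := by
    rw [hτ.card_free, Nat.one_le_iff_ne_zero, ← Nat.pos_iff_ne_zero, Finset.card_pos]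
    exact ⟨z, by simp [hzD]⟩
  rw [h1]
  have h3 : (1 : ℝ) ≤ (B.free τ (B.part z)).card := by exact_mod_cast h2
  have h4 := mul_le_mul_of_nonneg_left (n_le_of_not_large hz)
    (by have := B.e_pos; positivity : 0 ≤ 3 * B.Δ * B.e)
  have h5 := mul_le_mul_of_nonneg_left h3 B.ε_pos.le
  linarith [P.e_mul_T]

variable {P}

lemma Buffer.exists_embed_nbs (h : P.Buffer S Q) : ∃ σ, B.Valid (B.weight Q) σ ∧
    σ.D = Finset.univ.filter (fun x => ¬ P.Large (B.part x)) ∪ B.nbs S := by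
  obtain ⟨σ, hσ, hD⟩ := P.exists_embed_small Q
  refine (hσ.exists_extend P.ε_le_half ε_le_weight (B.nbs S) ?_).imp
    fun τ hτ => ⟨hτ.1, by rw [hτ.2.2, hD]⟩
  intro τ hτ _ hτD z hz hzD
  have hl : P.Large (B.part z) := by
    simp only [nbs, Finset.mem_biUnion] at hz
    obtain ⟨s, hs, hz⟩ := hz
    exact h.large_of_mem (Finset.mem_union_left _ hs) (nb_sub_cn _ hz) (mem_cn_self z)
  refine P.typical_card hl ?_
  have h1 := hτ.card_C_inter_free z
  have h2 : ((B.cl (B.part z) ∩ τ.D).card : ℝ) ≤ (B.cl (B.part z) ∩ B.nbs S).card := by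
    refine Nat.cast_le.2 (Finset.card_le_card fun x hx => ?_)
    rw [Finset.mem_inter, mem_cl] at hx ⊢
    refine ⟨hx.1, (Finset.mem_union.1 (hτD hx.2)).resolve_left fun hx' => ?_⟩
    rw [hD, Finset.mem_filter, hx.1] at hx'
    exact hx'.2 hl
  have h3 := h.card_nbs_le (B.part z)
  have h4 := hτ.pow_le_C z hzD
  have h5 := mul_le_mul_of_nonneg_right (B.c₀_le_pow (B.emb_le τ z)) (B.n_nonneg (B.part z))
  have h6 : B.c₀ * P.δ / 2 * B.n (B.part z) ≤ B.c₀ / 4 * B.n (B.part z) := by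
    refine mul_le_mul_of_nonneg_right ?_ (B.n_nonneg _)
    have := mul_le_mul_of_nonneg_left P.δ_le B.c₀_pos.le
    linarith
  have h7 := mul_nonneg B.c₀_pos.le (B.n_nonneg (B.part z))
  linarith

/-- The free vertices which are candidates for unexpectedly few vertices of `S`. -/
noncomputable def bad (B : Setting α ι) (σ : State α) (S : Finset α) : Finset α :=
  Finset.univ.filter fun v => v ∈ B.free σ (B.part v) ∧
    (((S ∩ B.cl (B.part v)).filter (v ∈ σ.C ·)).card : ℝ) <
      B.c₀ / 2 * (S ∩ B.cl (B.part v)).card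

lemma Buffer.card_bad_le (h : P.Buffer S Q) (hσ : B.Valid (B.weight Q) σ)
    (hD : Disjoint σ.D Q) (i : ι) :
    (bad B σ S ∩ B.cl i).card ≤ (Q ∩ B.cl i).card := by
  by_cases hi : P.Large i
  · set W := bad B σ S ∩ B.cl i with hW
    set X := S ∩ B.cl i with hX
    have hsum : ∑ x ∈ X, ((σ.C x ∩ W).card : ℝ) ≤ X.card * (B.c₀ / 2 * W.card) := by
      calc ∑ x ∈ X, ((σ.C x ∩ W).card : ℝ) = ∑ u ∈ W, ((X.filter (u ∈ σ.C ·)).card : ℝ) := by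
            simp only [← Finset.sum_boole, Finset.inter_comm _ W, ← Finset.filter_mem_eq_inter]
            exact Finset.sum_comm
        _ ≤ ∑ u ∈ W, B.c₀ / 2 * X.card := by
            refine Finset.sum_le_sum fun u hu => ?_
            simp only [hW, bad, Finset.mem_inter, Finset.mem_filter, mem_cl] at hu
            have := hu.1.2.2.le
            rwa [hu.2] at this
        _ = _ := by rw [Finset.sum_const, nsmul_eq_mul]; ring
    have h1 := hσ.half_c₀_sq_mul_le_irreg Finset.inter_subset_right Finset.inter_subset_right hsum
    have h2 := hσ.irreg_le i hi.Δ_le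
    have h3 := load_le_of_disjoint (B := B) hD i
    have hn := hi.pos
    have h4 : B.irreg σ i ≤ 5 * B.n i ^ 2 * (B.ε * B.Δ * B.n i) :=
      h2.trans (mul_le_mul_of_nonneg_left h3 (by positivity))
    have h5 := h.le_S i hi
    have h6 : (P.β * B.n i / 2) ^ 2 ≤ (X.card : ℝ) ^ 2 :=
      pow_le_pow_left₀ (by have := P.β_pos; positivity) h5 2
    have h7 : (B.c₀ / 2) ^ 2 * (P.β * B.n i / 2) ^ 2 * W.card ≤
        5 * B.n i ^ 2 * (B.ε * B.Δ * B.n i) := by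
      refine le_trans ?_ (h1.trans h4)
      gcongr
    have h8 : B.n i ^ 2 * (B.c₀ ^ 2 * P.β ^ 2 * W.card) ≤
        B.n i ^ 2 * (B.c₀ ^ 2 * P.β ^ 2 * (P.ρ * B.n i / 2)) := by
      have := mul_le_mul_of_nonneg_right P.bad_le (pow_pos hn 3).le
      nlinarith
    have h9 : (W.card : ℝ) ≤ P.ρ * B.n i / 2 :=
      le_of_mul_le_mul_left (le_of_mul_le_mul_left h8 (by positivity))
        (by have := P.β_pos; have := B.c₀_pos; positivity)
    exact_mod_cast h9.trans (h.le_Q i hi)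
  · have hS : S ∩ B.cl i = ∅ := by
      refine Finset.eq_empty_iff_forall_notMem.2 fun x hx => hi ?_
      rw [Finset.mem_inter, mem_cl] at hx
      have := h.large x (Finset.mem_union_left _ hx.1)
      rwa [hx.2] at this
    have hW : bad B σ S ∩ B.cl i = ∅ := by
      refine Finset.eq_empty_iff_forall_notMem.2 fun x hx => ?_
      simp only [bad, Finset.mem_inter, Finset.mem_filter, mem_cl] at hx
      have := hx.1.2.2
      rw [hx.2, hS] at this
      simp at this
    simp [hW]

lemma Buffer.notMem_nbs (h : P.Buffer S Q) {x : α} (hx : x ∈ S ∪ Q) : x ∉ B.nbs S := by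
  intro hx'
  simp only [nbs, Finset.mem_biUnion, mem_nb] at hx'
  obtain ⟨s, hs, hsx⟩ := hx'
  exact h.far s (Finset.mem_union_left _ hs) x hx hsx.ne x (by simp [cn, hsx]) x (mem_cn_self x)
    (mem_cn_self x)

/-- Every bad vertex is covered by some vertex of the reserve. -/
lemma Buffer.exists_cover_bad (h : P.Buffer S Q) (hσ : B.Valid (B.weight Q) σ)
    (hD : σ.D = Finset.univ.filter (fun x => ¬ P.Large (B.part x)) ∪ B.nbs S) :
    ∃ τ, B.Valid (B.weight Q) τ ∧ B.Ext σ τ ∧ τ.D ⊆ σ.D ∪ Q ∧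
      ∀ i, Disjoint (B.free τ i) (bad B σ S) := by
  have hQD : ∀ z ∈ Q, ∀ x ∈ B.cn z, ∀ y ∈ B.cn x, y ∉ σ.D := by
    intro z hz x hx y hy hyD
    rw [hD, Finset.mem_union, Finset.mem_filter] at hyD
    rcases hyD with hyD | hyD
    · exact hyD.2 (h.large_of_mem (Finset.mem_union_right _ hz) hx hy)
    · simp only [nbs, Finset.mem_biUnion, mem_nb] at hyD
      obtain ⟨s, hs, hsy⟩ := hyD
      have hne : s ≠ z := fun hsz => Finset.disjoint_left.1 h.disj hs (hsz ▸ hz)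
      exact h.far s (Finset.mem_union_left _ hs) z (Finset.mem_union_right _ hz) hne y
        (by simp [cn, hsy]) x (mem_cn_comm.1 hy) hx
  suffices H : ∀ Y ⊆ bad B σ S, ∃ τ, ∃ E ⊆ Q, B.Valid (B.weight Q) τ ∧ B.Ext σ τ ∧
      τ.D = σ.D ∪ E ∧ E.image τ.f = Y by
    obtain ⟨τ, E, hE, hτ, hext, hDE, him⟩ := H _ subset_rfl
    refine ⟨τ, hτ, hext, ?_, fun i => Finset.disjoint_left.2 fun u hu hub => ?_⟩
    · rw [hDE]
      exact Finset.union_subset_union_right hE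
    · rw [← him, Finset.mem_image] at hub
      obtain ⟨x, hx, hxu⟩ := hub
      exact (mem_free.1 hu).2 x (by rw [hDE]; exact Finset.mem_union_right _ hx) hxu
  intro Y
  induction Y using Finset.induction_on with
  | empty => exact fun _ => ⟨σ, ∅, by simp, hσ, Ext.refl, by simp, by simp⟩
  | insert v Y hvY ih =>
    intro hY
    obtain ⟨τ, E, hE, hτ, hext, hDE, him⟩ := ih ((Finset.subset_insert _ _).trans hY)
    have hvb := hY (Finset.mem_insert_self v Y)
    have hvf : v ∈ B.free τ (B.part v) := by
      have hvσ : v ∈ B.free σ (B.part v) := (Finset.mem_filter.1 hvb).2.1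
      refine mem_free.2 ⟨rfl, fun x hx hxv => ?_⟩
      rw [hDE, Finset.mem_union] at hx
      rcases hx with hx | hx
      · rw [hext.f_eq x hx] at hxv
        exact (mem_free.1 hvσ).2 x hx hxv
      · exact hvY (by rw [← him, ← hxv]; exact Finset.mem_image_of_mem _ hx)
    obtain ⟨z, hzQ, hzE⟩ : ∃ z ∈ Q ∩ B.cl (B.part v), z ∉ E := by
      by_contra! hcon
      have h1 : (Q ∩ B.cl (B.part v)).card ≤ (Y ∩ B.cl (B.part v)).card := by
        refine Finset.card_le_card_of_injOn τ.f (fun x hx => ?_) fun x hx y hy hxy => ?_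
        · have hxE := hcon x hx
          simp only [Finset.coe_inter, Set.mem_inter_iff, Finset.mem_coe, mem_cl] at hx ⊢
          refine ⟨by rw [← him]; exact Finset.mem_image_of_mem _ hxE, ?_⟩
          rw [hτ.part_f x (by rw [hDE]; exact Finset.mem_union_right _ hxE), hx.2]
        · refine hτ.injOn ?_ ?_ hxy
          · rw [hDE]
            exact Finset.mem_union_right _ (hcon x hx)
          · rw [hDE]
            exact Finset.mem_union_right _ (hcon y hy)
      have h2 := h.card_bad_le hσ (Finset.disjoint_left.2 fun y hy hyQ =>
        hQD y hyQ y (mem_cn_self y) y (mem_cn_self y) hy) (B.part v)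
      have h3 : (Y ∩ B.cl (B.part v)).card < (bad B σ S ∩ B.cl (B.part v)).card := by
        refine Finset.card_lt_card ((Finset.ssubset_iff_of_subset
          (Finset.inter_subset_inter_right ((Finset.subset_insert _ _).trans hY))).2 ⟨v, ?_, ?_⟩)
        · simp [hvb]
        · simp [hvY]
      omega
    rw [Finset.mem_inter, mem_cl] at hzQ
    have hzD : ∀ x ∈ B.cn z, ∀ y ∈ B.cn x, y ≠ z → y ∉ τ.D := by
      intro x hx y hy hyz hyD
      rw [hDE, Finset.mem_union] at hyD
      rcases hyD with hyD | hyD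
      · exact hQD z hzQ.1 x hx y hy hyD
      · exact h.far z (Finset.mem_union_right _ hzQ.1) y (Finset.mem_union_right _ (hE hyD))
          hyz.symm x hx y hy (mem_cn_self y)
    have hzτ : z ∉ τ.D := by
      rw [hDE, Finset.mem_union, not_or]
      exact ⟨hQD z hzQ.1 z (mem_cn_self z) z (mem_cn_self z), hzE⟩
    have hstep : B.Step (B.weight Q z) τ z v := by
      rw [weight, if_pos hzQ.1]
      refine hτ.step_of_full hzτ (by rwa [hzQ.2]) (fun w hw hzw => ?_) fun y hy w hw hyw => ?_
      · exact hzD z (mem_cn_self z) w (by simp [cn, hzw]) hzw.ne' hw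
      · exact hzD y (by simp [cn, hy]) w (by simp [cn, hyw]) (fun hwz => hzτ (hwz ▸ hw)) hw
    refine ⟨B.step τ z v, insert z E, Finset.insert_subset hzQ.1 hE,
      hτ.step (ε_le_weight z) hstep, hext.trans (Ext.step hzτ), ?_, ?_⟩
    · rw [Finset.union_insert, ← hDE]
      rfl
    · rw [Finset.image_insert]
      have h1 : (B.step τ z v).f z = v := by simp [step]
      have h2 : E.image (B.step τ z v).f = E.image τ.f :=
        Finset.image_congr fun x hx => by
          have hxz : x ≠ z := fun hxz => hzE (hxz ▸ hx)
          simp [step, hxz]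
      rw [h1, h2, him]

variable (P) in
/-- The vertices of cluster `i` with few unused candidates. -/
noncomputable def crit (σ : State α) (i : ι) : Finset α :=
  (B.cl i).filter fun x => B.spare σ x < 2 * P.δ * B.n i

variable (P) in
/-- The invariant maintained while the vertices outside the buffer are embedded. -/
structure Inv (S Q : Finset α) (σ : State α) : Prop where
  valid : B.Valid (B.weight Q) σ
  large : ∀ x, x ∉ σ.D → P.Large (B.part x)
  nb_sub : ∀ b ∈ S, B.nb b ⊆ σ.D
  good : ∀ i, ∀ u ∈ B.free σ i, B.c₀ / 2 * (S ∩ B.cl i).card ≤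
    (((S ∩ B.cl i).filter (u ∈ σ.C ·)).card : ℝ)
  embedded_sub : ∀ i, S ∩ B.cl i ∩ σ.D ⊆ P.crit σ i
  embedded_le : ∀ i, P.Large i → ((S ∩ B.cl i ∩ σ.D).card : ℝ) ≤ P.θ * B.n i
  le_spare : ∀ x, x ∉ σ.D → B.γ ^ B.emb σ x * (P.δ * B.n (B.part x)) ≤
    B.spare σ x + (P.crit σ (B.part x) ∩ σ.D).card

lemma θ_le_β (P : B.Params) : 32 * P.θ ≤ P.β := by
  have h1 := P.θ_le
  have h2 := P.δ_le'
  have h3 := mul_le_mul_of_nonneg_right B.c₀_le_one P.δ_pos.le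
  have h4 := mul_le_mul_of_nonneg_right B.c₀_le_one P.β_pos.le
  linarith

lemma Inv.le_card_free (h : P.Inv S Q σ) (hB : P.Buffer S Q) {i : ι} (hi : P.Large i) :
    P.β * B.n i / 4 ≤ (B.free σ i).card := by
  have h1 := h.embedded_le i hi
  have h2 := hB.le_S i hi
  have h3 : ((S ∩ B.cl i).card : ℝ) ≤ (B.free σ i).card + (S ∩ B.cl i ∩ σ.D).card := by
    rw [h.valid.card_free]
    have h4 : (S ∩ B.cl i) ⊆ (B.cl i \ σ.D) ∪ (S ∩ B.cl i ∩ σ.D) := by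
      intro x
      simp only [Finset.mem_inter, Finset.mem_union, Finset.mem_sdiff]
      tauto
    exact_mod_cast (Finset.card_le_card h4).trans (Finset.card_union_le _ _)
  have h5 := mul_le_mul_of_nonneg_right P.θ_le_β (B.n_nonneg i)
  have h6 := mul_nonneg P.β_pos.le (B.n_nonneg i)
  linarith

lemma _root_.ArxivOG.BlowUp.Setting.Valid.irreg_le_mul (h : B.Valid (B.weight Q) σ)
    (hB : P.Buffer S Q) {i : ι} (hi : P.Large i) : B.irreg σ i ≤ 5 * P.L * B.n i ^ 3 := by
  have h1 := h.irreg_le i hi.Δ_le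
  have h2 := mul_le_mul_of_nonneg_left (hB.load_le σ.D i)
    (by positivity : 0 ≤ 5 * B.n i ^ 2)
  linarith

lemma Inv.card_crit_le (h : P.Inv S Q σ) (hB : P.Buffer S Q) {i : ι} (hi : P.Large i) :
    ((P.crit σ i).card : ℝ) ≤ P.θ * B.n i := by
  have hn := hi.pos
  have hβ := P.β_pos
  have hc := B.c₀_pos
  have hf := h.le_card_free hB hi
  have h1 : ∑ x ∈ P.crit σ i, ((σ.C x ∩ B.free σ i).card : ℝ) ≤
      (P.crit σ i).card * (B.c₀ / 2 * (B.free σ i).card) := by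
    rw [← nsmul_eq_mul, ← Finset.sum_const]
    refine Finset.sum_le_sum fun x hx => ?_
    rw [crit, Finset.mem_filter, mem_cl, spare] at hx
    have h2 := hx.2.le
    rw [hx.1] at h2
    have h3 := mul_le_mul_of_nonneg_right P.δ_le' hn.le
    have h4 := mul_le_mul_of_nonneg_left hf hc.le
    linarith
  have h2 := (h.valid.half_c₀_sq_mul_le_irreg (Finset.filter_subset _ _) Finset.sdiff_subset
    h1).trans (h.valid.irreg_le_mul hB hi)
  have h3 : (B.c₀ / 2) ^ 2 * ((P.crit σ i).card : ℝ) ^ 2 * (P.β * B.n i / 4) ≤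
      5 * P.L * B.n i ^ 3 := le_trans (mul_le_mul_of_nonneg_left hf (by positivity)) h2
  have h4 := mul_le_mul_of_nonneg_right P.L_le (pow_pos hn 3).le
  have h5 : (B.c₀ ^ 2 * P.β * B.n i) * ((P.crit σ i).card : ℝ) ^ 2 ≤
      (B.c₀ ^ 2 * P.β * B.n i) * (P.θ * B.n i) ^ 2 := by
    nlinarith
  exact le_of_sq_le_sq (le_of_mul_le_mul_left h5 (by positivity))
    (mul_nonneg P.θ_pos.le hn.le)

lemma crit_sub_crit_step (hz : z ∉ σ.D) (i : ι) : P.crit σ i ⊆ P.crit (B.step σ z v) i := by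
  intro y hy
  rw [crit, Finset.mem_filter] at hy ⊢
  exact ⟨hy.1, (spare_step_le hz y).trans_lt hy.2⟩

lemma Inv.exists_step (h : P.Inv S Q σ) (hB : P.Buffer S Q) {x : α} (hx : x ∉ σ.D)
    (hxS : x ∈ P.crit σ (B.part x) ∨ x ∉ S ∧ ∀ y ∉ σ.D, y ∉ P.crit σ (B.part y)) :
    ∃ v, P.Inv S Q (B.step σ x v) := by
  have hδ := P.δ_pos
  have hc := B.c₀_pos
  have hγ := B.γ_pos
  have hpow : ∀ y ∉ σ.D, B.c₀ * (P.δ * B.n (B.part y)) ≤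
      B.spare σ y + (P.crit σ (B.part y) ∩ σ.D).card := fun y hy =>
    (mul_le_mul_of_nonneg_right (B.c₀_le_pow (B.emb_le σ y))
      (mul_nonneg hδ.le (B.n_nonneg _))).trans (h.le_spare y hy)
  obtain ⟨v, hty, hst⟩ := h.valid.exists_step (w := B.weight Q x) P.ε_le_half (ε_le_weight x) hx (by
    refine P.typical_card (h.large x hx) ?_
    have h1 := hpow x hx
    have h2 : ((P.crit σ (B.part x) ∩ σ.D).card : ℝ) ≤ (P.crit σ (B.part x)).card := by
      exact_mod_cast Finset.card_le_card Finset.inter_subset_left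
    have h3 := h.card_crit_le hB (h.large x hx)
    have h4 := mul_le_mul_of_nonneg_right P.θ_le (B.n_nonneg (B.part x))
    change _ ≤ B.spare σ x
    linarith)
  have hval := h.valid.step (ε_le_weight x) hst
  have hemb : ∀ i, S ∩ B.cl i ∩ (B.step σ x v).D ⊆ P.crit σ i := by
    intro i y hy
    simp only [step, Finset.mem_inter, Finset.mem_insert, mem_cl] at hy
    rcases hy.2 with hyx | hyD
    · rw [hyx] at hy ⊢
      rw [← hy.1.2]
      exact hxS.resolve_right fun hc => hc.1 hy.1.1
    · exact h.embedded_sub i (by simp [hy.1, hyD])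
  refine ⟨v, hval, fun y hy => h.large y fun hyD => hy (Finset.mem_insert_of_mem hyD),
    fun b hb => (h.nb_sub b hb).trans (Finset.subset_insert _ _), fun i u hu => ?_,
    fun i => (hemb i).trans (crit_sub_crit_step hx i), fun i hi => ?_, fun y hy => ?_⟩
  · have hext : B.Ext σ (B.step σ x v) := Ext.step hx
    refine (h.good i u (hext.free_sub i hu)).trans (le_of_eq ?_)
    congr 2
    refine Finset.filter_congr fun b hb => ?_
    rw [hext.C_eq b (h.nb_sub b (Finset.mem_inter.1 hb).1)]
  · exact (Nat.cast_le.2 (Finset.card_le_card (hemb i))).trans (h.card_crit_le hB hi)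
  · have hy' : y ∉ σ.D := fun hyD => hy (Finset.mem_insert_of_mem hyD)
    have hyx : y ≠ x := fun hyx => hy (by rw [hyx]; exact Finset.mem_insert_self _ _)
    have hn := (h.large y hy').pos
    have hq : ((P.crit σ (B.part y) ∩ σ.D).card : ℝ) ≤
        (P.crit (B.step σ x v) (B.part y) ∩ (B.step σ x v).D).card :=
      Nat.cast_le.2 (Finset.card_le_card (Finset.inter_subset_inter (crit_sub_crit_step hx _)
        (Finset.subset_insert _ _)))
    have hvx := hst.part_eq
    have h1 := h.le_spare y hy'
    by_cases hxy : B.H.Adj x y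
    · have hne : B.part v ≠ B.part y := fun he => by
        have := B.part_H _ _ hxy
        rw [← hvx, he] at this
        exact B.R_irrefl _ this
      have hs : B.spare (B.step σ x v) y =
          (((σ.C y ∩ B.free σ (B.part y)).filter (B.G.Adj v)).card : ℝ) := by
        rw [spare, free_step hx, Finset.erase_eq_of_notMem
          (fun hv => hne (mem_free.1 hv).1)]
        simp only [step, if_pos (And.intro hxy hy')]
        rw [Finset.filter_inter]
      have h2 := err_ge hvx hxy (hty y hxy hy').2.2
      rw [← hs] at h2
      rw [emb_step_of_adj hx hxy, pow_succ']
      have h3 := mul_le_mul_of_nonneg_right P.ε_le hn.le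
      have h4 := hpow y hy'
      have h5 := mul_le_mul_of_nonneg_left h1 hγ.le
      have h6 := mul_le_mul_of_nonneg_left h4 hγ.le
      have h7 : (0 : ℝ) ≤ (P.crit σ (B.part y) ∩ σ.D).card := Nat.cast_nonneg _
      have h8 := mul_le_mul_of_nonneg_right B.γ_le h7
      change 3 / 2 * B.γ * B.spare σ y - _ ≤ _ at h2
      linarith
    · rw [emb_step_of_not_adj hxy]
      have hC : (B.step σ x v).C y = σ.C y := by simp [step, hxy]
      by_cases hpart : B.part y = B.part x
      · have hs : B.spare σ y - 1 ≤ B.spare (B.step σ x v) y := by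
          rw [spare, spare, hC, free_step hx, Finset.inter_erase]
          have := Finset.pred_card_le_card_erase (s := σ.C y ∩ B.free σ (B.part y)) (a := v)
          have h2 : (σ.C y ∩ B.free σ (B.part y)).card ≤
            ((σ.C y ∩ B.free σ (B.part y)).erase v).card + 1 := by omega
          have h3 : ((σ.C y ∩ B.free σ (B.part y)).card : ℝ) ≤
            ((σ.C y ∩ B.free σ (B.part y)).erase v).card + 1 := by exact_mod_cast h2
          linarith
        rcases hxS with hxc | ⟨-, hnc⟩
        · have hq' : ((P.crit σ (B.part y) ∩ σ.D).card : ℝ) + 1 ≤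
              (P.crit (B.step σ x v) (B.part y) ∩ (B.step σ x v).D).card := by
            have : (P.crit σ (B.part y) ∩ σ.D).card <
                (P.crit (B.step σ x v) (B.part y) ∩ (B.step σ x v).D).card := by
              refine Finset.card_lt_card ((Finset.ssubset_iff_of_subset
                (Finset.inter_subset_inter (crit_sub_crit_step hx _)
                (Finset.subset_insert _ _))).2 ⟨x, ?_, by simp [hx]⟩)
              rw [hpart]
              exact Finset.mem_inter.2 ⟨crit_sub_crit_step hx _ hxc, Finset.mem_insert_self _ _⟩
            exact_mod_cast this
          linarith
        · have h2 : 2 * P.δ * B.n (B.part y) ≤ B.spare σ y := by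
            by_contra hlt
            exact hnc y hy' (by simpa [crit] using hlt)
          have h3 := mul_le_mul_of_nonneg_left (h.large y hy').lt.le hδ.le
          have h4 := mul_le_mul_of_nonneg_right (B.pow_le_one' (B.emb σ y))
            (mul_nonneg hδ.le hn.le)
          have h5 : (0 : ℝ) ≤ (P.crit (B.step σ x v) (B.part y) ∩ (B.step σ x v).D).card :=
            Nat.cast_nonneg _
          linarith [P.δ_mul_T]
      · have hs : B.spare (B.step σ x v) y = B.spare σ y := by
          rw [spare, spare, hC, free_step hx, Finset.erase_eq_of_notMem]
          intro hv
          exact hpart (by rw [← (mem_free.1 hv).1, hvx])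
        rw [hs]
        linarith

lemma Inv.exists_final (h : P.Inv S Q σ) (hB : P.Buffer S Q) :
    ∃ τ, P.Inv S Q τ ∧ ∀ x ∉ τ.D, x ∈ S ∧ x ∉ P.crit τ (B.part x) := by
  induction hm : (Finset.univ \ σ.D).card using Nat.strong_induction_on generalizing σ with
  | _ m ih =>
    by_cases hfin : ∀ x ∉ σ.D, x ∈ S ∧ x ∉ P.crit σ (B.part x)
    · exact ⟨σ, h, hfin⟩
    · obtain ⟨x, hx, hxS⟩ : ∃ x ∉ σ.D, x ∈ P.crit σ (B.part x) ∨
          x ∉ S ∧ ∀ y ∉ σ.D, y ∉ P.crit σ (B.part y) := by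
        by_cases hcr : ∃ x ∉ σ.D, x ∈ P.crit σ (B.part x)
        · obtain ⟨x, hx, hxc⟩ := hcr
          exact ⟨x, hx, Or.inl hxc⟩
        · push Not at hcr hfin
          obtain ⟨x, hx, hxS⟩ := hfin
          exact ⟨x, hx, Or.inr ⟨fun hS => hcr x hx (hxS hS), hcr⟩⟩
      obtain ⟨v, hv⟩ := h.exists_step hB hx hxS
      refine ih _ ?_ hv rfl
      rw [← hm]
      refine Finset.card_lt_card (Finset.ssubset_iff_of_subset
        (Finset.sdiff_subset_sdiff subset_rfl (Finset.subset_insert _ _)) |>.2 ⟨x, ?_, ?_⟩)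
      · simp [hx]
      · simp

lemma Buffer.exists_inv (hB : P.Buffer S Q) : ∃ τ, P.Inv S Q τ := by
  obtain ⟨σ, hσ, hD⟩ := hB.exists_embed_nbs
  obtain ⟨τ, hτ, hext, hτD, hbad⟩ := hB.exists_cover_bad hσ hD
  have hlarge : ∀ x, x ∉ τ.D → P.Large (B.part x) := by
    intro x hx
    by_contra hl
    exact hx (hext.D_sub (by rw [hD]; simp [hl]))
  have hnb : ∀ b ∈ S, B.nb b ⊆ σ.D := by
    intro b hb y hy
    rw [hD]
    exact Finset.mem_union_right _ (Finset.mem_biUnion.2 ⟨b, hb, hy⟩)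
  have hSD : ∀ i, S ∩ B.cl i ∩ τ.D = ∅ := by
    intro i
    refine Finset.eq_empty_iff_forall_notMem.2 fun x hx => ?_
    rw [Finset.mem_inter, Finset.mem_inter] at hx
    have hxS := Finset.mem_union_left Q hx.1.1
    have := hτD hx.2
    rw [Finset.mem_union, hD, Finset.mem_union, Finset.mem_filter] at this
    rcases this with (h | h) | h
    · exact h.2 (hB.large x hxS)
    · exact hB.notMem_nbs hxS h
    · exact Finset.disjoint_left.1 hB.disj hx.1.1 h
  refine ⟨τ, hτ, hlarge, fun b hb => (hnb b hb).trans hext.D_sub, fun i u hu => ?_,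
    fun i => by simp [hSD], fun i hi => ?_, fun x hx => ?_⟩
  · have h1 := hext.free_sub i hu
    have hui := (mem_free.1 hu).1
    have h2 := Finset.disjoint_left.1 (hbad i) hu
    rw [bad, Finset.mem_filter, hui] at h2
    have h3 := not_lt.1 fun hlt => h2 ⟨Finset.mem_univ _, h1, hlt⟩
    refine h3.trans (le_of_eq ?_)
    congr 2
    refine Finset.filter_congr fun b hb => ?_
    rw [hext.C_eq b (hnb b (Finset.mem_inter.1 hb).1)]
  · rw [hSD]
    simpa using mul_nonneg P.θ_pos.le (B.n_nonneg i)
  · have hn := B.n_nonneg (B.part x)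
    have h1 := hτ.card_C_inter_free x
    have h2 : ((B.cl (B.part x) ∩ τ.D).card : ℝ) ≤
        (B.cl (B.part x) ∩ B.nbs S).card + (Q ∩ B.cl (B.part x)).card := by
      have : B.cl (B.part x) ∩ τ.D ⊆ (B.cl (B.part x) ∩ B.nbs S) ∪ (Q ∩ B.cl (B.part x)) := by
        intro y hy
        rw [Finset.mem_inter, mem_cl] at hy
        have h3 := hτD hy.2
        rw [Finset.mem_union, hD, Finset.mem_union, Finset.mem_filter, hy.1] at h3
        have h4 := hlarge x hx
        simp only [Finset.mem_union, Finset.mem_inter, mem_cl]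
        tauto
      exact_mod_cast (Finset.card_le_card this).trans (Finset.card_union_le _ _)
    have h3 := hB.card_nbs_le (B.part x)
    have h4 := hB.Q_le (B.part x)
    have h5 := mul_le_mul_of_nonneg_right P.ρ_le hn
    have h6 := hτ.pow_le_C x hx
    have h7 := mul_le_mul_of_nonneg_right (B.c₀_le_pow (B.emb_le τ x)) hn
    have h8 : B.γ ^ B.emb τ x * (P.δ * B.n (B.part x)) ≤
        B.γ ^ B.emb τ x * (1 / 2 * B.n (B.part x)) :=
      mul_le_mul_of_nonneg_left (mul_le_mul_of_nonneg_right P.δ_le hn)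
        (pow_pos B.γ_pos _).le
    have h9 : (0 : ℝ) ≤ (P.crit τ (B.part x) ∩ τ.D).card := Nat.cast_nonneg _
    have h10 := mul_nonneg B.c₀_pos.le hn
    change _ ≤ B.spare τ x at h1
    linarith

lemma Inv.card_le_card_biUnion (h : P.Inv S Q σ) (hB : P.Buffer S Q) {i : ι} {A : Finset α}
    (hA : ∀ x ∈ A, B.part x = i ∧ x ∉ σ.D ∧ x ∉ P.crit σ i) :
    A.card ≤ (A.biUnion fun x => σ.C x ∩ B.free σ i).card := by
  set N := A.biUnion fun x => σ.C x ∩ B.free σ i with hN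
  by_contra! hlt
  have hδ := P.δ_pos
  have hβ := P.β_pos
  have hc := B.c₀_pos
  obtain ⟨a, ha⟩ : A.Nonempty := Finset.card_pos.1 (by omega)
  obtain ⟨hai, haD, hac⟩ := hA a ha
  have hi : P.Large i := hai ▸ h.large a haD
  have hn := hi.pos
  have hAδ : 2 * P.δ * B.n i ≤ A.card := by
    have h1 : 2 * P.δ * B.n i ≤ B.spare σ a := by
      by_contra hlt
      exact hac (by simpa [crit, hai] using hlt)
    have h2 : B.spare σ a ≤ N.card := by
      rw [spare, hai]
      exact Nat.cast_le.2 (Finset.card_le_card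
        (Finset.subset_biUnion_of_mem (fun x => σ.C x ∩ B.free σ i) ha))
    have h3 : (N.card : ℝ) ≤ A.card := by exact_mod_cast hlt.le
    linarith
  have hNf : N ⊆ B.free σ i := Finset.biUnion_subset.2 fun x _ => Finset.inter_subset_right
  have hAcl : A ⊆ B.cl i \ σ.D := fun x hx => by simp [(hA x hx).1, (hA x hx).2.1]
  have hfree := h.valid.card_free i
  obtain ⟨u, hu, huN⟩ := Finset.exists_mem_notMem_of_card_lt_card
    (hlt.trans_le ((Finset.card_le_card hAcl).trans_eq hfree.symm))
  have hWcard : B.c₀ * P.β * B.n i / 8 ≤ (B.free σ i \ N).card := by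
    set Y := (S ∩ B.cl i).filter (u ∈ σ.C ·) with hY
    have h1 : A ∪ (Y \ σ.D) ⊆ B.cl i \ σ.D := by
      refine Finset.union_subset hAcl (Finset.sdiff_subset_sdiff ?_ subset_rfl)
      exact (Finset.filter_subset _ _).trans Finset.inter_subset_right
    have h2 : Disjoint A (Y \ σ.D) := by
      refine Finset.disjoint_left.2 fun x hxA hxY => huN ?_
      rw [Finset.mem_sdiff, hY, Finset.mem_filter] at hxY
      exact Finset.mem_biUnion.2 ⟨x, hxA, Finset.mem_inter.2 ⟨hxY.1.2, hu⟩⟩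
    have h3 := Finset.card_le_card h1
    rw [Finset.card_union_of_disjoint h2, ← hfree] at h3
    have h4 : Y.card ≤ (Y \ σ.D).card + (S ∩ B.cl i ∩ σ.D).card := by
      have : Y ⊆ (Y \ σ.D) ∪ (S ∩ B.cl i ∩ σ.D) := by
        intro x hx
        have hxS := (Finset.mem_filter.1 hx).1
        rw [Finset.mem_union, Finset.mem_sdiff, Finset.mem_inter]
        tauto
      exact (Finset.card_le_card this).trans (Finset.card_union_le _ _)
    have h5 := Finset.card_sdiff_add_card_eq_card hNf
    have h6 : (Y.card : ℝ) ≤ (B.free σ i \ N).card + (S ∩ B.cl i ∩ σ.D).card := by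
      exact_mod_cast (by omega : Y.card ≤ (B.free σ i \ N).card + (S ∩ B.cl i ∩ σ.D).card)
    have h7 := h.good i u hu
    have h8 := h.embedded_le i hi
    have h9 := mul_le_mul_of_nonneg_left (hB.le_S i hi) hc.le
    have h10 : P.θ * B.n i ≤ B.c₀ * P.β * B.n i / 8 := by
      have := P.θ_le
      have := P.δ_le'
      have := mul_le_mul_of_nonneg_right B.c₀_le_one hδ.le
      calc P.θ * B.n i ≤ (B.c₀ * P.β / 8) * B.n i :=
            mul_le_mul_of_nonneg_right (by linarith) hn.le
        _ = _ := by ring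
    change _ ≤ (Y.card : ℝ) at h7
    linarith
  have hsum : ∑ x ∈ A, ((σ.C x ∩ (B.free σ i \ N)).card : ℝ) ≤
      A.card * (B.c₀ / 2 * (B.free σ i \ N).card) := by
    rw [Finset.sum_eq_zero]
    · positivity
    · intro x hx
      rw [Nat.cast_eq_zero, Finset.card_eq_zero, Finset.eq_empty_iff_forall_notMem]
      intro w hw
      rw [Finset.mem_inter, Finset.mem_sdiff] at hw
      exact hw.2.2 (Finset.mem_biUnion.2 ⟨x, hx, Finset.mem_inter.2 ⟨hw.1, hw.2.1⟩⟩)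
  have h1 := (h.valid.half_c₀_sq_mul_le_irreg (hAcl.trans Finset.sdiff_subset)
    (Finset.sdiff_subset.trans Finset.sdiff_subset) hsum).trans (h.valid.irreg_le_mul hB hi)
  have h2 : (2 * P.δ * B.n i) ^ 2 ≤ (A.card : ℝ) ^ 2 := pow_le_pow_left₀ (by positivity) hAδ 2
  have h3 : (B.c₀ / 2) ^ 2 * (2 * P.δ * B.n i) ^ 2 * (B.c₀ * P.β * B.n i / 8) ≤
      5 * P.L * B.n i ^ 3 := by
    refine le_trans ?_ h1
    exact mul_le_mul (mul_le_mul_of_nonneg_left h2 (by positivity)) hWcard (by positivity)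
      (by positivity)
  have h4 := mul_lt_mul_of_pos_right P.L_lt (pow_pos hn 3)
  linarith

lemma Inv.exists_embedding (h : P.Inv S Q σ) (hB : P.Buffer S Q)
    (hfin : ∀ x ∉ σ.D, x ∈ S ∧ x ∉ P.crit σ (B.part x)) :
    ∃ f : α → α, Function.Injective f ∧ (∀ x y, B.H.Adj x y → B.G.Adj (f x) (f y)) ∧
      ∀ x, B.part (f x) = B.part x := by
  obtain ⟨g, hg, hgmem⟩ := (Finset.all_card_le_biUnion_card_iff_exists_injective
    (fun x : {x // x ∉ σ.D} => σ.C x ∩ B.free σ (B.part x))).1 (by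
    intro s
    set A : Finset α := s.map (Function.Embedding.subtype _) with hA
    have hAD : ∀ x ∈ A, x ∉ σ.D := by
      intro x hx
      obtain ⟨y, -, rfl⟩ := Finset.mem_map.1 hx
      exact y.2
    have h1 : s.biUnion (fun x : {x // x ∉ σ.D} => σ.C x ∩ B.free σ (B.part x)) =
        A.biUnion (fun x => σ.C x ∩ B.free σ (B.part x)) := by
      ext u
      simp [hA]
    rw [h1, ← Finset.card_map (Function.Embedding.subtype _), ← hA, ← sum_card_inter_cl (B := B) A,
      ← sum_card_inter_cl (B := B) (A.biUnion _)]
    refine Finset.sum_le_sum fun i _ => ?_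
    refine (h.card_le_card_biUnion hB (i := i) (A := A ∩ B.cl i) fun x hx => ?_).trans
      (Finset.card_le_card fun u hu => ?_)
    · rw [Finset.mem_inter, mem_cl] at hx
      have hxD := hAD x hx.1
      exact ⟨hx.2, hxD, hx.2 ▸ (hfin x hxD).2⟩
    · obtain ⟨x, hx, hu⟩ := Finset.mem_biUnion.1 hu
      rw [Finset.mem_inter, mem_cl] at hx
      refine Finset.mem_inter.2 ⟨Finset.mem_biUnion.2 ⟨x, hx.1, by rwa [hx.2]⟩, ?_⟩
      exact B.mem_cl.2 (mem_free.1 (Finset.mem_inter.1 hu).2).1)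
  have hgC : ∀ x : {x // x ∉ σ.D}, g x ∈ σ.C x := fun x => (Finset.mem_inter.1 (hgmem x)).1
  have hgf : ∀ x : {x // x ∉ σ.D}, B.part (g x) = B.part (x : α) ∧ ∀ y ∈ σ.D, σ.f y ≠ g x :=
    fun x => mem_free.1 (Finset.mem_inter.1 (hgmem x)).2
  have hadj : ∀ x (hx : x ∉ σ.D), ∀ y ∈ σ.D, B.H.Adj x y → B.G.Adj (σ.f y) (g ⟨x, hx⟩) :=
    fun x hx y hy hxy => (h.valid.mem_C x hx _ (hgf ⟨x, hx⟩).1).1 (hgC ⟨x, hx⟩) y hy hxy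
  refine ⟨fun x => if hx : x ∈ σ.D then σ.f x else g ⟨x, hx⟩, fun x y hxy => ?_,
    fun x y hxy => ?_, fun x => ?_⟩
  · by_cases hx : x ∈ σ.D <;> by_cases hy : y ∈ σ.D <;> simp only [hx, hy, dif_pos, dif_neg,
      not_false_eq_true] at hxy
    · exact h.valid.injOn hx hy hxy
    · exact absurd hxy ((hgf ⟨y, hy⟩).2 x hx)
    · exact absurd hxy.symm ((hgf ⟨x, hx⟩).2 y hy)
    · exact congrArg Subtype.val (hg hxy)
  · by_cases hx : x ∈ σ.D <;> by_cases hy : y ∈ σ.D <;> simp only [hx, hy, dif_pos, dif_neg,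
      not_false_eq_true]
    · exact h.valid.adj x hx y hy hxy
    · exact hadj y hy x hx hxy.symm
    · exact (hadj x hx y hy hxy).symm
    · exact absurd (h.nb_sub x (hfin x hx).1 (B.mem_nb.2 hxy)) hy
  · by_cases hx : x ∈ σ.D <;> simp only [hx, dif_pos, dif_neg, not_false_eq_true]
    · exact h.valid.part_f x hx
    · exact (hgf ⟨x, hx⟩).1

lemma exists_embedding (P : B.Params) :
    ∃ f : α → α, Function.Injective f ∧ (∀ x y, B.H.Adj x y → B.G.Adj (f x) (f y)) ∧
      ∀ x, B.part (f x) = B.part x := by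
  obtain ⟨S, Q, hB⟩ := P.exists_buffer
  obtain ⟨σ, hσ⟩ := hB.exists_inv
  obtain ⟨τ, hτ, hfin⟩ := hσ.exists_final hB
  exact hτ.exists_embedding hB hfin

end Params

end Setting

section Regularity

variable {α : Type*} (G : α → α → Prop) {A B : Finset α} {η : ℝ}

lemma eCnt_eq_sum (A B : Finset α) :
    eCnt G (A : Set α) (B : Set α) = ∑ v ∈ A, (B.filter (G v)).card := by
  have h : {p : α × α | p.1 ∈ (A : Set α) ∧ p.2 ∈ (B : Set α) ∧ G p.1 p.2} =
      ((A ×ˢ B).filter fun p => G p.1 p.2 : Finset (α × α)) := by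
    ext p
    simp [and_assoc]
  rw [eCnt, h, Set.ncard_coe_finset, Finset.card_filter, Finset.sum_product]
  exact Finset.sum_congr rfl fun v _ => (Finset.card_filter _ _).symm

lemma eCnt_le (A B : Finset α) : (eCnt G (A : Set α) (B : Set α) : ℝ) ≤ A.card * B.card := by
  rw [eCnt_eq_sum]
  exact_mod_cast (Finset.sum_le_sum fun v _ => Finset.card_filter_le B (G v)).trans_eq
    (by rw [Finset.sum_const, smul_eq_mul])

lemma dens_nonneg (A B : Set α) : 0 ≤ ArxivOG.dens G A B := by
  unfold ArxivOG.dens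
  positivity

lemma dens_le_one (A B : Finset α) : ArxivOG.dens G (A : Set α) (B : Set α) ≤ 1 := by
  rw [ArxivOG.dens, Set.ncard_coe_finset, Set.ncard_coe_finset]
  exact div_le_one_of_le₀ (eCnt_le G A B) (by positivity)

variable {G}

lemma abs_eCnt_sub_le (h : EpsRegular η G (A : Set α) (B : Set α)) (hη : 0 ≤ η) {X Y : Finset α}
    (hX : X ⊆ A) (hY : Y ⊆ B) :
    |(eCnt G (X : Set α) (Y : Set α) : ℝ) -
      ArxivOG.dens G (A : Set α) (B : Set α) * (X.card * Y.card)| ≤ η * A.card * B.card := by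
  have hXA : (X.card : ℝ) ≤ A.card := Nat.cast_le.2 (Finset.card_le_card hX)
  have hYB : (Y.card : ℝ) ≤ B.card := Nat.cast_le.2 (Finset.card_le_card hY)
  have hX0 : (0 : ℝ) ≤ X.card := Nat.cast_nonneg _
  have hY0 : (0 : ℝ) ≤ Y.card := Nat.cast_nonneg _
  have hE := eCnt_le G X Y
  have hE0 : (0 : ℝ) ≤ eCnt G (X : Set α) (Y : Set α) := Nat.cast_nonneg _
  have hd0 := dens_nonneg G (A : Set α) (B : Set α)
  have hd1 := dens_le_one G A B
  set t := ArxivOG.dens G (A : Set α) (B : Set α)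
  have hXY : (0 : ℝ) ≤ X.card * Y.card := mul_nonneg hX0 hY0
  have htriv : |(eCnt G (X : Set α) (Y : Set α) : ℝ) - t * (X.card * Y.card)| ≤
      X.card * Y.card := by
    have := mul_nonneg hd0 hXY
    have := mul_le_mul_of_nonneg_right hd1 hXY
    rw [abs_le]
    constructor <;> linarith
  by_cases hXs : (X.card : ℝ) ≤ η * A.card
  · exact htriv.trans (mul_le_mul hXs hYB hY0 (by positivity))
  by_cases hYs : (Y.card : ℝ) ≤ η * B.card
  · refine htriv.trans ((mul_le_mul hXA hYs hY0 (by positivity)).trans_eq (by ring))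
  push Not at hXs hYs
  have hXp : (0 : ℝ) < X.card := lt_of_le_of_lt (by positivity) hXs
  have hYp : (0 : ℝ) < Y.card := lt_of_le_of_lt (by positivity) hYs
  have hreg := h X (Finset.coe_subset.2 hX) Y (Finset.coe_subset.2 hY)
    (by simpa [Set.ncard_coe_finset] using hXs) (by simpa [Set.ncard_coe_finset] using hYs)
  have heq : (eCnt G (X : Set α) (Y : Set α) : ℝ) - t * (X.card * Y.card) =
      (ArxivOG.dens G (X : Set α) (Y : Set α) - t) * (X.card * Y.card) := by
    rw [ArxivOG.dens, Set.ncard_coe_finset, Set.ncard_coe_finset]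
    field_simp
  rw [heq, abs_mul, abs_of_nonneg hXY]
  refine (mul_le_mul hreg.le (mul_le_mul hXA hYB hY0 (by positivity)) hXY hη).trans_eq (by ring)

lemma sum_abs_card_filter_sub_le (h : EpsRegular η G (A : Set α) (B : Set α)) (hη : 0 ≤ η)
    {Y : Finset α} (hY : Y ⊆ B) :
    ∑ v ∈ A, |((Y.filter (G v)).card : ℝ) - ArxivOG.dens G (A : Set α) (B : Set α) * Y.card| ≤
      2 * η * A.card * B.card := by
  set x : α → ℝ := fun v =>
    ((Y.filter (G v)).card : ℝ) - ArxivOG.dens G (A : Set α) (B : Set α) * Y.card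
  have key : ∀ X ⊆ A, |∑ v ∈ X, x v| ≤ η * A.card * B.card := by
    intro X hX
    refine le_of_eq_of_le ?_ (abs_eCnt_sub_le h hη hX hY)
    rw [eCnt_eq_sum, Finset.sum_sub_distrib, Finset.sum_const, nsmul_eq_mul, Nat.cast_sum]
    ring_nf
  have h1 := (le_abs_self _).trans (key _ (Finset.filter_subset (0 ≤ x ·) A))
  have h2 := (neg_le_abs _).trans (key _ (Finset.filter_subset (¬ 0 ≤ x ·) A))
  have h3 : ∑ v ∈ A.filter (0 ≤ x ·), |x v| = ∑ v ∈ A.filter (0 ≤ x ·), x v :=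
    Finset.sum_congr rfl fun v hv => abs_of_nonneg (Finset.mem_filter.1 hv).2
  have h4 : ∑ v ∈ A.filter (¬ 0 ≤ x ·), |x v| = -∑ v ∈ A.filter (¬ 0 ≤ x ·), x v := by
    rw [← Finset.sum_neg_distrib]
    exact Finset.sum_congr rfl fun v hv =>
      abs_of_nonpos (not_le.1 (Finset.mem_filter.1 hv).2).le
  change ∑ v ∈ A, |x v| ≤ _
  rw [← Finset.sum_filter_add_sum_filter_not A (0 ≤ x ·), h3, h4]
  linarith

lemma le_dens_of_le_degree {t : ℝ} (hA : A.Nonempty) (hB : B.Nonempty)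
    (h : ∀ a ∈ A, t * B.card ≤ ((B.filter (G a)).card : ℝ)) :
    t ≤ ArxivOG.dens G (A : Set α) (B : Set α) := by
  have hA' : (0 : ℝ) < A.card := Nat.cast_pos.2 hA.card_pos
  have hB' : (0 : ℝ) < B.card := Nat.cast_pos.2 hB.card_pos
  rw [ArxivOG.dens, Set.ncard_coe_finset, Set.ncard_coe_finset, le_div_iff₀ (by positivity),
    eCnt_eq_sum, Nat.cast_sum]
  calc t * (A.card * B.card) = ∑ _v ∈ A, t * (B.card : ℝ) := by
        rw [Finset.sum_const, nsmul_eq_mul]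
        ring
    _ ≤ _ := Finset.sum_le_sum h

end Regularity

lemma exists_threshold (ι : Type*) [Fintype ι] {c t : ℝ} (hc : 0 < c) (hc1 : c ≤ 1) (ht : 0 < t) :
    ∃ t', ∀ n : ι → ℝ, ∃ T, t ≤ T ∧ T ≤ t' ∧ ∀ i, n i ≤ T ∨ T < c * n i := by
  have hmono : ∀ {s s' : ℕ}, s ≤ s' → t / c ^ s ≤ t / c ^ s' := fun hs =>
    div_le_div_of_nonneg_left ht.le (pow_pos hc _) (pow_le_pow_of_le_one hc.le hc1 hs)
  refine ⟨t / c ^ Fintype.card ι, fun n => ?_⟩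
  by_contra! hbad
  choose i hi using fun s : Fin (Fintype.card ι + 1) =>
    hbad (t / c ^ (s : ℕ)) (by simpa using hmono (Nat.zero_le (s : ℕ))) (hmono (by omega))
  obtain ⟨s, s', hne, heq⟩ := Fintype.exists_ne_map_eq_of_card_lt i (by simp)
  wlog hlt : s < s' generalizing s s'
  · exact this s' s hne.symm heq.symm (lt_of_le_of_ne (not_lt.1 hlt) hne.symm)
  have h1 := (hi s).2
  have h2 := (hi s').1
  rw [← heq] at h2
  have h3 : t / c ^ ((s : ℕ) + 1) ≤ t / c ^ (s' : ℕ) := hmono hlt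
  have h4 : n (i s) ≤ t / c ^ ((s : ℕ) + 1) := by
    rw [pow_succ, ← div_div, le_div_iff₀ hc]
    linarith
  linarith

/-- The part of `Setting.Params` that does not depend on the sizes of the clusters, where `K`
stands for the number of clusters. -/
structure Constants (K Δ : ℕ) (γ c₀ : ℝ) where
  c : ℝ
  β : ℝ
  ρ : ℝ
  δ : ℝ
  θ : ℝ
  L : ℝ
  ε : ℝ
  c_pos : 0 < c
  c_le_one : c ≤ 1
  β_pos : 0 < β
  ρ_pos : 0 < ρ
  δ_pos : 0 < δ
  δ_le : δ ≤ 1 / 2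
  θ_pos : 0 < θ
  ε_pos : 0 < ε
  ε_le_one : ε ≤ 1
  select : K * (Δ + 1 : ℝ) ^ 3 * (β + ρ) + K * (Δ + 1 : ℝ) ^ 2 * c ≤ 1
  β_le : Δ * K * β ≤ c * (c₀ / 8)
  ρ_le : ρ ≤ c₀ / 8
  ε_le : ε ≤ γ * c₀ * δ / 2
  bad_le : 160 * ε * Δ ≤ c₀ ^ 2 * β ^ 2 * ρ
  load_le : Δ * ε * c + Δ * K * ρ ≤ L * c
  L_le : 80 * L ≤ c₀ ^ 2 * β * θ ^ 2
  δ_le' : 16 * δ ≤ c₀ * β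
  θ_le : θ ≤ c₀ * δ / 2
  L_lt : 40 * L < c₀ ^ 3 * δ ^ 2 * β

lemma exists_pos_mul_le {a b : ℝ} (ha : 0 ≤ a) (hb : 0 < b) :
    ∃ x₀ > 0, ∀ x, 0 < x → x ≤ x₀ → a * x < b := by
  refine ⟨b / (a + 1), by positivity, fun x hx h => ?_⟩
  rw [le_div_iff₀ (by positivity)] at h
  linarith

lemma nonempty_constants (K Δ : ℕ) {γ c₀ : ℝ} (hγ : 0 < γ) (hc₀ : 0 < c₀) (hc₀' : c₀ ≤ 1) :
    Nonempty (Constants K Δ γ c₀) := by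
  obtain ⟨c₁, hc₁, hc⟩ := exists_pos_mul_le (a := K * (Δ + 1 : ℝ) ^ 2) (b := 1 / 2)
    (by positivity) (by norm_num)
  set c := min c₁ 1
  have hcp : 0 < c := lt_min hc₁ one_pos
  have hc := hc c hcp (min_le_left _ _)
  obtain ⟨β₁, hβ₁, hβ⟩ := exists_pos_mul_le (a := K * (Δ + 1 : ℝ) ^ 3) (b := 1 / 4)
    (by positivity) (by norm_num)
  obtain ⟨β₂, hβ₂, hβ'⟩ := exists_pos_mul_le (a := (Δ * K : ℝ)) (b := c * (c₀ / 8))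
    (by positivity) (by positivity)
  set β := min (min β₁ β₂) 1
  have hβp : 0 < β := lt_min (lt_min hβ₁ hβ₂) one_pos
  have hβ1 : β ≤ 1 := min_le_right _ _
  have hβ := hβ β hβp ((min_le_left _ _).trans (min_le_left _ _))
  have hβ' := hβ' β hβp ((min_le_left _ _).trans (min_le_right _ _))
  have hcβ : c₀ * β ≤ 1 := mul_le_one₀ hc₀' hβp.le hβ1
  set δ := c₀ * β / 16
  have hδp : 0 < δ := by positivity
  set θ := c₀ * δ / 2
  have hθp : 0 < θ := by positivity
  set L := c₀ ^ 2 * β * θ ^ 2 / 80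
  have hLp : 0 < L := by positivity
  obtain ⟨ρ₁, hρ₁, hρ⟩ := exists_pos_mul_le (a := K * (Δ + 1 : ℝ) ^ 3) (b := 1 / 4)
    (by positivity) (by norm_num)
  obtain ⟨ρ₂, hρ₂, hρ'⟩ := exists_pos_mul_le (a := (Δ * K : ℝ)) (b := L * c / 2)
    (by positivity) (by positivity)
  set ρ := min (min ρ₁ ρ₂) (c₀ / 8)
  have hρp : 0 < ρ := lt_min (lt_min hρ₁ hρ₂) (by positivity)
  have hρ := hρ ρ hρp ((min_le_left _ _).trans (min_le_left _ _))
  have hρ' := hρ' ρ hρp ((min_le_left _ _).trans (min_le_right _ _))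
  obtain ⟨ε₁, hε₁, hε⟩ := exists_pos_mul_le (a := (Δ * c : ℝ)) (b := L * c / 2)
    (by positivity) (by positivity)
  obtain ⟨ε₂, hε₂, hε'⟩ := exists_pos_mul_le (a := (160 * Δ : ℝ)) (b := c₀ ^ 2 * β ^ 2 * ρ)
    (by positivity) (by positivity)
  set ε := min (min ε₁ ε₂) (min 1 (γ * c₀ * δ / 2))
  have hεp : 0 < ε := lt_min (lt_min hε₁ hε₂) (lt_min one_pos (by positivity))
  have hε := hε ε hεp ((min_le_left _ _).trans (min_le_left _ _))
  have hε' := hε' ε hεp ((min_le_left _ _).trans (min_le_right _ _))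
  exact ⟨{
    c, β, ρ, δ, θ, L, ε
    c_pos := hcp
    c_le_one := min_le_right _ _
    β_pos := hβp
    ρ_pos := hρp
    δ_pos := hδp
    δ_le := by change c₀ * β / 16 ≤ _; linarith
    θ_pos := hθp
    ε_pos := hεp
    ε_le_one := (min_le_right _ _).trans (min_le_left _ _)
    select := by linarith
    β_le := hβ'.le
    ρ_le := min_le_right _ _
    ε_le := (min_le_right _ _).trans (min_le_right _ _)
    bad_le := by linarith
    load_le := by linarith
    L_le := by change 80 * (c₀ ^ 2 * β * θ ^ 2 / 80) ≤ _; linarith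
    δ_le' := by change 16 * (c₀ * β / 16) ≤ _; linarith
    θ_le := le_rfl
    L_lt := by
      change 40 * (c₀ ^ 2 * β * (c₀ * δ / 2) ^ 2 / 80) < _
      have h1 : 0 < c₀ ^ 3 * δ ^ 2 * β := by positivity
      have h2 := mul_le_mul_of_nonneg_right hc₀' h1.le
      linarith }⟩

theorem blow_up_of_constants {ι : Type*} [Fintype ι] {Δ : ℕ} (F : SimpleGraph ι) {d γ : ℝ}
    (hγ : 0 < γ) (hγ' : γ ≤ 1 / 2) (hd : 2 * γ ≤ d)
    (P : Constants (Fintype.card ι) Δ γ (γ ^ Δ)) :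
    ∃ η₀ : ℝ, 0 < η₀ ∧
    ∀ (α : Type) [Fintype α] (part : α → ι), part.Surjective →
    ∀ η : ℝ, 0 < η → η ≤ η₀ →
    ∀ G H : SimpleGraph α,
    (∀ i j, F.Adj i j → SuperRegular η d G.Adj {v | part v = i} {v | part v = j}) →
    (∀ x y, H.Adj x y → F.Adj (part x) (part y)) →
    (∀ v, (H.neighborSet v).ncard ≤ Δ) →
    ∃ f : α → α, Function.Injective f ∧ (∀ x y, H.Adj x y → G.Adj (f x) (f y)) ∧
      ∀ x, part (f x) = part x := by
  have hc₀ : 0 < γ ^ Δ := pow_pos hγ Δ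
  have hε := P.ε_pos
  have hβ := P.β_pos
  have hρ := P.ρ_pos
  have hδ := P.δ_pos
  set t : ℝ := 1 + Δ / P.ε + 8 / P.β + 2 / P.ρ + 1 / P.δ
  have ht : 1 ≤ t ∧ Δ / P.ε ≤ t ∧ 8 / P.β ≤ t ∧ 2 / P.ρ ≤ t ∧ 1 / P.δ ≤ t := by
    have h1 : 0 ≤ Δ / P.ε := by positivity
    have h2 : 0 ≤ 8 / P.β := by positivity
    have h3 : 0 ≤ 2 / P.ρ := by positivity
    have h4 : 0 ≤ 1 / P.δ := by positivity
    refine ⟨?_, ?_, ?_, ?_, ?_⟩ <;> linarith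
  obtain ⟨t', ht'⟩ := exists_threshold ι P.c_pos P.c_le_one (one_pos.trans_le ht.1)
  obtain ⟨e₁, he₁, he⟩ := exists_pos_mul_le (a := (3 * Δ : ℝ)) (b := P.ε * (γ ^ Δ * P.δ / 4))
    (by positivity) (by positivity)
  obtain ⟨e₂, he₂, he'⟩ := exists_pos_mul_le (a := 3 * Δ * |t'|) (b := P.ε)
    (by positivity) (by positivity)
  obtain ⟨e₃, he₃, he''⟩ := exists_pos_mul_le (a := t' ^ 2) (b := γ) (by positivity) hγ
  set e := min (min e₁ e₂) e₃
  have hep : 0 < e := lt_min (lt_min he₁ he₂) he₃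
  have he := he e hep ((min_le_left _ _).trans (min_le_left _ _))
  have he' := he' e hep ((min_le_left _ _).trans (min_le_right _ _))
  have he'' := he'' e hep (min_le_right _ _)
  refine ⟨min (γ / 2) (e / 2), lt_min (by positivity) (by positivity), ?_⟩
  intro α _ part hpart η hη hη₀ G H hG hH hΔ
  have hηγ : η ≤ γ / 2 := hη₀.trans (min_le_left _ _)
  have hηe : η ≤ e / 2 := hη₀.trans (min_le_right _ _)
  set A : ι → Finset α := fun i => Finset.univ.filter (part · = i)
  have hA : ∀ i, {v | part v = i} = (A i : Set α) := fun i => by simp [A]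
  have hAne : ∀ i, (A i).Nonempty := fun i => (hpart i).imp fun v hv => by simp [A, hv]
  simp only [hA] at hG
  have hdeg : ∀ i j, F.Adj i j → ∀ v ∈ A i,
      3 / 2 * γ * (A j).card ≤ (((A j).filter (G.Adj v)).card : ℝ) := by
    intro i j hij v hv
    have h1 := (hG i j hij).2.1 v hv
    have h2 : outN G.Adj v ∩ (A j : Set _) = ((A j).filter (G.Adj v) : Finset _) := by
      ext w
      simp [outN, and_comm]
    rw [h2, Set.ncard_coe_finset, Set.ncard_coe_finset] at h1
    exact (mul_le_mul_of_nonneg_right (by linarith) (Nat.cast_nonneg _)).trans h1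
  obtain ⟨D, hD⟩ : ∃ D : ι → ι → ℝ,
      ∀ i j, D i j = ArxivOG.dens G.Adj (A i : Set α) (A j : Set α) := ⟨_, fun _ _ => rfl⟩
  let B : Setting α ι := {
    part := part
    R := F.Adj
    R_symm := fun _ _ h => h.symm
    R_irrefl := fun i => F.irrefl
    G := G
    H := H
    part_H := hH
    dens := D
    Δ := Δ
    γ := γ
    ε := P.ε
    e := e
    γ_pos := hγ
    γ_le := hγ'
    ε_pos := hε
    ε_le_one := P.ε_le_one
    e_pos := hep
    le_dens := fun i j h => hD i j ▸ le_dens_of_le_degree (hAne i) (hAne j) (hdeg i j h)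
    dens_le := fun i j _ => hD i j ▸ dens_le_one _ _ _
    degree_le := fun x => by
      refine le_of_eq_of_le ?_ (hΔ x)
      rw [← Set.ncard_coe_finset]
      congr 1
      ext y
      simp
    sum_deviation_le := fun i j h S hS => by
      rw [hD]
      refine (sum_abs_card_filter_sub_le (hG j i h.symm).1 hη.le hS).trans ?_
      refine le_of_le_of_eq (mul_le_mul_of_nonneg_right (mul_le_mul_of_nonneg_right
        (by linarith : 2 * η ≤ e) (Nat.cast_nonneg _)) (Nat.cast_nonneg _)) (mul_right_comm _ _ _)
    le_degree := fun v j h =>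
      (mul_le_mul_of_nonneg_right (by linarith) (Nat.cast_nonneg _)).trans
        (hdeg (part v) j h v (by simp [A])) }
  obtain ⟨T, hT, hTt', hTn⟩ := ht' B.n
  have hTp : 0 < T := by linarith
  have hTabs : T ≤ |t'| := hTt'.trans (le_abs_self _)
  let Q : B.Params := {
    c := P.c, β := P.β, ρ := P.ρ, δ := P.δ, θ := P.θ, T := T, L := P.L
    c_pos := P.c_pos
    c_le_one := P.c_le_one
    β_pos := hβ
    ρ_pos := hρ
    δ_pos := hδ
    δ_le := P.δ_le
    θ_pos := P.θ_pos
    T_pos := hTp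
    small_or_large := hTn
    select := P.select
    β_le := P.β_le
    ρ_le := P.ρ_le
    ε_le := P.ε_le
    Δ_le := (div_le_iff₀' hε).1 (ht.2.1.trans hT)
    β_mul_T := (div_le_iff₀' hβ).1 (ht.2.2.1.trans hT)
    ρ_mul_T := (div_le_iff₀' hρ).1 (ht.2.2.2.1.trans hT)
    δ_mul_T := (div_le_iff₀' hδ).1 (ht.2.2.2.2.trans hT)
    e_le := he.le
    e_mul_T := by
      refine lt_of_le_of_lt ?_ he'
      calc 3 * (Δ : ℝ) * e * T ≤ 3 * Δ * e * |t'| := by gcongr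
        _ = _ := by ring
    e_mul_sq := by
      refine lt_of_le_of_lt ?_ he''
      calc e * T ^ 2 ≤ e * t' ^ 2 := by gcongr
        _ = _ := mul_comm _ _
    bad_le := P.bad_le
    load_le := P.load_le
    L_le := P.L_le
    δ_le' := P.δ_le'
    θ_le := P.θ_le
    L_lt := P.L_lt }
  exact Q.exists_embedding

end BlowUp

/-- **Lemma 6 (Blow-up Lemma, Komlós–Sárközy–Szemerédi).**
Given a graph `F` on `[k]` and positive `d, Δ`, there is `η₀ > 0` such that for all positive
`ℓ₁, …, ℓ_k` and all `0 < η ≤ η₀` the following holds. Let `F'` be the blow-up of `F`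
obtained by replacing each vertex `i` by a set `V_i` of `ℓ_i` vertices (so the vertex set is
`Σ i, Fin (ℓ i)` and `V_i = {v | v.1 = i}`). If `G'` is a spanning subgraph of `F'` in which
every pair corresponding to an edge of `F` is `(η,d)`-super-regular, then `G'` contains a
copy of every subgraph `H` of `F'` with `Δ(H) ≤ Δ`; moreover the copy maps every vertex into
the same `V_i` as in `F'`. -/
theorem blow_up_lemma_kss
    (k : ℕ) (F : SimpleGraph (Fin k)) (d : ℝ) (hd : 0 < d) (Δ : ℕ) (hΔ : 0 < Δ) :
    ∃ η₀ : ℝ, 0 < η₀ ∧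
    ∀ ℓ : Fin k → ℕ, (∀ i, 0 < ℓ i) →
    ∀ η : ℝ, 0 < η → η ≤ η₀ →
    ∀ G' : SimpleGraph (Σ i : Fin k, Fin (ℓ i)),
    -- `G'` is a spanning subgraph of the blow-up `F'`
    (∀ x y : (Σ i : Fin k, Fin (ℓ i)), G'.Adj x y → F.Adj x.1 y.1) →
    -- every pair of clusters corresponding to an edge of `F` is `(η,d)`-super-regular
    (∀ i j : Fin k, F.Adj i j →
      SuperRegular η d G'.Adj {v : Σ i : Fin k, Fin (ℓ i) | v.1 = i}
        {v : Σ i : Fin k, Fin (ℓ i) | v.1 = j}) →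
    -- `H` is a subgraph of `F'` with maximum degree at most `Δ`
    ∀ H : SimpleGraph (Σ i : Fin k, Fin (ℓ i)),
    (∀ x y, H.Adj x y → F.Adj x.1 y.1) →
    (∀ v, (H.neighborSet v).ncard ≤ Δ) →
    ∃ f : (Σ i : Fin k, Fin (ℓ i)) → (Σ i : Fin k, Fin (ℓ i)),
      Function.Injective f ∧
      (∀ x y, H.Adj x y → G'.Adj (f x) (f y)) ∧
      (∀ x, (f x).1 = x.1) := by
  have hγ : 0 < min d 1 / 2 := by positivity
  have hγ1 : min d 1 / 2 ≤ 1 / 2 := by linarith [min_le_right d 1]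
  obtain ⟨P⟩ := BlowUp.nonempty_constants (Fintype.card (Fin k)) Δ hγ (pow_pos hγ Δ)
    (pow_le_one₀ hγ.le (by linarith))
  obtain ⟨η₀, hη₀, h⟩ := BlowUp.blow_up_of_constants F hγ hγ1
    (by linarith [min_le_left d 1] : 2 * (min d 1 / 2) ≤ d) P
  exact ⟨η₀, hη₀, fun ℓ hℓ η hη hη' G' _ hG' H hH hΔ =>
    h _ Sigma.fst (fun i => ⟨⟨i, ⟨0, hℓ i⟩⟩, rfl⟩) η hη hη' G' H hG' hH hΔ⟩

end ArxivOG
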